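/- arXiv:1701.01379 — 12 statements merged into one kernel-verified Lean document; each statement's English description precedes it below -/
import Mathlib

section
/- In any finite projective plane Π_q of order q, every saturating set S satisfies |S| > √(2q) + 1 (as real numbers). -/
/-- A finite projective plane of order `q`: any two distinct points lie on a
unique line, any two distinct lines meet in a unique point, there is a
nondegenerate quadrilateral, every line has `q+1` points, every point lies on
`q+1` lines, and there are `q^2+q+1` points and `q^2+q+1` lines. -/
structure ProjPlane (Point Line : Type*) (q : ℕ) where
  Incid : Point → Line → Prop
  exists_unique_line : ∀ ⦃p p' : Point⦄, p ≠ p' →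
    ∃! l : Line, Incid p l ∧ Incid p' l
  exists_unique_point : ∀ ⦃l l' : Line⦄, l ≠ l' →
    ∃! p : Point, Incid p l ∧ Incid p l'
  nondegenerate : ∃ a b c d : Point,
    a ≠ b ∧ a ≠ c ∧ a ≠ d ∧ b ≠ c ∧ b ≠ d ∧ c ≠ d ∧
    ∀ l : Line,
      ¬(Incid a l ∧ Incid b l ∧ Incid c l) ∧
      ¬(Incid a l ∧ Incid b l ∧ Incid d l) ∧
      ¬(Incid a l ∧ Incid c l ∧ Incid d l) ∧
      ¬(Incid b l ∧ Incid c l ∧ Incid d l)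
  card_line_points : ∀ l : Line, Nat.card {p : Point // Incid p l} = q + 1
  card_point_lines : ∀ p : Point, Nat.card {l : Line // Incid p l} = q + 1
  card_points : Nat.card Point = q ^ 2 + q + 1
  card_lines : Nat.card Line = q ^ 2 + q + 1

/-- A point `x` is saturated by a point set `S` if `x ∈ S` or some line
contains `x` and two distinct points of `S`. -/
def ProjPlane.Saturated {Point Line : Type*} {q : ℕ}
    (PP : ProjPlane Point Line q) (S : Set Point) (x : Point) : Prop :=
  x ∈ S ∨ ∃ l : Line, PP.Incid x l ∧
    ∃ a ∈ S, ∃ b ∈ S, a ≠ b ∧ PP.Incid a l ∧ PP.Incid b l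

/-- A set of points is a saturating set if every point of the plane is
saturated by it. -/
def ProjPlane.SaturatingSet {Point Line : Type*} {q : ℕ}
    (PP : ProjPlane Point Line q) (S : Set Point) : Prop :=
  ∀ x : Point, PP.Saturated S x

namespace ProjPlane

variable {Point Line : Type*} {q : ℕ} (PP : ProjPlane Point Line q)

theorem line_eq {p p' : Point} (h : p ≠ p') {l l' : Line} (hp : PP.Incid p l)
    (hp' : PP.Incid p' l) (kp : PP.Incid p l') (kp' : PP.Incid p' l') : l = l' :=
  (PP.exists_unique_line h).unique ⟨hp, hp'⟩ ⟨kp, kp'⟩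

theorem point_eq {l l' : Line} (h : l ≠ l') {p p' : Point} (hp : PP.Incid p l)
    (hp' : PP.Incid p l') (kp : PP.Incid p' l) (kp' : PP.Incid p' l') : p = p' :=
  (PP.exists_unique_point h).unique ⟨hp, hp'⟩ ⟨kp, kp'⟩

/-- A set of at most `q` points not containing `s` misses some line through `s`. -/
theorem exists_line_disjoint {s : Point} (T : Finset Point) (hsT : s ∉ T) (hT : T.card ≤ q) :
    ∃ l, PP.Incid s l ∧ ∀ t ∈ T, ¬PP.Incid t l := by
  classical
  by_contra! h
  have : Finite {l : Line // PP.Incid s l} :=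
    Nat.finite_of_card_ne_zero (by rw [PP.card_point_lines]; omega)
  choose f hfT hf using fun l : {l : Line // PP.Incid s l} => h l.1 l.2
  have hinj : Function.Injective fun l => (⟨f l, hfT l⟩ : T) := by
    intro l l' hll
    have hll : f l = f l' := congrArg Subtype.val hll
    have hne : s ≠ f l := fun e => hsT (e ▸ hfT l)
    exact Subtype.ext (PP.line_eq hne l.2 (hf l) l'.2 (hll ▸ hf l'))
  have := Nat.card_le_card_of_injective _ hinj
  rw [PP.card_point_lines, Nat.card_eq_fintype_card, Fintype.card_coe] at this
  omega

/-- If a line meets a saturating set only in `s`, then its other `q` points are covered by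
distinct pairs of points of the set, none of them involving `s`. -/
theorem le_choose_two_of_tangent {s : Point} {T : Finset Point}
    (hS : PP.SaturatingSet (insert s (T : Set Point))) {l : Line}
    (hsl : PP.Incid s l) (hl : ∀ t ∈ T, ¬PP.Incid t l) : q ≤ T.card.choose 2 := by
  classical
  have : Finite {p : Point // PP.Incid p l} :=
    Nat.finite_of_card_ne_zero (by rw [PP.card_line_points]; omega)
  have : Fintype {p : Point // PP.Incid p l} := Fintype.ofFinite _
  have key : ∀ x : {p : Point // PP.Incid p l}, x ≠ ⟨s, hsl⟩ →
      ∃ P ∈ T.powersetCard 2, ∃ m, PP.Incid x.1 m ∧ ∀ p ∈ P, PP.Incid p m := by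
    rintro ⟨x, hxl⟩ hxs
    have hxs : x ≠ s := fun e => hxs (Subtype.ext e)
    rcases hS x with (hx | hx) | ⟨m, hxm, a, ha, b, hb, hab, ham, hbm⟩
    · exact absurd hx hxs
    · exact absurd hxl (hl x hx)
    have hsm : ¬PP.Incid s m := by
      intro hsm
      obtain rfl := PP.line_eq hxs hxm hsm hxl hsl
      rcases ha with rfl | ha
      · rcases hb with rfl | hb
        · exact hab rfl
        · exact hl b hb hbm
      · exact hl a ha ham
    have haT : a ∈ T := ha.resolve_left fun e => hsm (e ▸ ham)
    have hbT : b ∈ T := hb.resolve_left fun e => hsm (e ▸ hbm)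
    refine ⟨{a, b}, ?_, m, hxm, by simp [ham, hbm]⟩
    simp [Finset.mem_powersetCard, Finset.card_pair hab, Finset.insert_subset_iff, haT, hbT]
  have : Nonempty Line := ⟨l⟩
  choose! f hfT m hxm hfm using key
  have hcard : (Finset.univ.erase (⟨s, hsl⟩ : {p : Point // PP.Incid p l})).card = q := by
    rw [Finset.card_erase_of_mem (Finset.mem_univ _), Finset.card_univ,
      ← Nat.card_eq_fintype_card, PP.card_line_points, Nat.add_sub_cancel]
  rw [← hcard, ← Finset.card_powersetCard]
  refine Finset.card_le_card_of_injOn f (fun x hx => hfT x (Finset.ne_of_mem_erase hx)) ?_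
  intro x hx y hy hxy
  have hx := Finset.ne_of_mem_erase hx
  have hy := Finset.ne_of_mem_erase hy
  obtain ⟨hsub, h2⟩ := Finset.mem_powersetCard.mp (hfT x hx)
  obtain ⟨a, b, hab, hP⟩ := Finset.card_eq_two.mp h2
  have ha : a ∈ f x := by simp [hP]
  have hb : b ∈ f x := by simp [hP]
  have hm : m x = m y := PP.line_eq hab (hfm x hx a ha) (hfm x hx b hb)
    (hfm y hy a (hxy ▸ ha)) (hfm y hy b (hxy ▸ hb))
  have hml : m x ≠ l := fun e => hl a (hsub ha) (e ▸ hfm x hx a ha)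
  exact Subtype.ext (PP.point_eq hml (hxm x hx) x.2 (hm ▸ hxm y hy) y.2)

theorem SaturatingSet.nonempty {PP : ProjPlane Point Line q} {S : Set Point}
    (hS : PP.SaturatingSet S) : S.Nonempty := by
  obtain ⟨p, -⟩ := PP.nondegenerate
  rcases hS p with hp | ⟨-, -, a, ha, -⟩
  exacts [⟨p, hp⟩, ⟨a, ha⟩]

end ProjPlane

/-- In any finite projective plane of order q, every saturating set S
satisfies |S| > √(2q) + 1. -/
theorem saturating_set_lower_bound {Point Line : Type*} {q : ℕ} (hq : 2 ≤ q)
    (PP : ProjPlane Point Line q) (S : Set Point)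
    (hS : PP.SaturatingSet S) :
    Real.sqrt (2 * q) + 1 < (S.ncard : ℝ) := by
  classical
  have : Finite Point := Nat.finite_of_card_ne_zero (by rw [PP.card_points]; omega)
  obtain ⟨s, hs⟩ := hS.nonempty
  obtain ⟨T, hT⟩ := (S \ {s}).toFinite.exists_finset_coe
  have hsT : s ∉ T := by
    rw [← Finset.mem_coe, hT]
    simp
  have hST : S = insert s (T : Set Point) := by
    rw [hT, Set.insert_sdiff_singleton, Set.insert_eq_of_mem hs]
  have hcard : S.ncard = T.card + 1 := by
    rw [hST, Set.ncard_insert_of_notMem (by simpa using hsT), Set.ncard_coe_finset]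
  have hlt : 2 * q < T.card ^ 2 := by
    rcases Nat.lt_or_ge q T.card with h | h
    · nlinarith
    · obtain ⟨l, hsl, hl⟩ := PP.exists_line_disjoint T hsT h
      have hle := PP.le_choose_two_of_tangent (hST ▸ hS) hsl hl
      rw [Nat.choose_two_right, Nat.le_div_iff_mul_le two_pos] at hle
      rcases hn : T.card with _ | n
      · simp [hn] at hle
        omega
      · rw [hn, Nat.add_sub_cancel] at hle
        nlinarith
  have hsq : (2 * q : ℝ) < (T.card : ℝ) ^ 2 := by exact_mod_cast hlt
  have hpos : (0 : ℝ) < T.card := Nat.cast_pos.mpr (by nlinarith)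
  have hsqrt := (Real.sqrt_lt' hpos).mpr hsq
  rw [hcard, Nat.cast_succ]
  linarith
end

section
/- In any finite projective plane Π_q of order q ≥ 2, there exists a saturating set S with |S| ≤ √(4(q+1)·ln(q+1)) + 2 (as real numbers). -/
namespace ProjPlane

open Finset

lemma finite_point {Point Line : Type*} {q : ℕ} (PP : ProjPlane Point Line q) : Finite Point :=
  Nat.finite_of_card_ne_zero (by rw [PP.card_points]; omega)

variable {Point Line : Type*} {q : ℕ} (PP : ProjPlane Point Line q)

lemma incid_line_eq {a b : Point} {l l' : Line} (hab : a ≠ b)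
    (hal : PP.Incid a l) (hbl : PP.Incid b l) (hal' : PP.Incid a l') (hbl' : PP.Incid b l') :
    l = l' :=
  (PP.exists_unique_line hab).unique ⟨hal, hbl⟩ ⟨hal', hbl'⟩

lemma Saturated.mono {S T : Set Point} (h : S ⊆ T) {x : Point} (hx : PP.Saturated S x) :
    PP.Saturated T x := by
  rcases hx with hx | ⟨l, hl, a, ha, b, hb, hab⟩
  · exact Or.inl (h hx)
  · exact Or.inr ⟨l, hl, a, h ha, b, h hb, hab⟩

open Classical in
lemma card_filter_incid [Fintype Point] (l : Line) :
    #{p : Point | PP.Incid p l} = q + 1 := by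
  rw [← PP.card_line_points l, Nat.card_eq_fintype_card, Fintype.card_subtype]

/-- The points not saturated by `S`. -/
noncomputable def unsaturated [Fintype Point] (S : Finset Point) : Finset Point :=
  open Classical in {x : Point | ¬ PP.Saturated (S : Set Point) x}

lemma mem_unsaturated [Fintype Point] {S : Finset Point} {x : Point} :
    x ∈ PP.unsaturated S ↔ ¬ PP.Saturated (S : Set Point) x := by
  simp [unsaturated]

open Classical in
lemma exists_pair_card_unsaturated_le [Fintype Point] :
    ∃ S : Finset Point, #S = 2 ∧ #(PP.unsaturated S) ≤ q ^ 2 := by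
  obtain ⟨a, b, -, -, hab, -⟩ := PP.nondegenerate
  obtain ⟨l, ⟨hal, hbl⟩, -⟩ := PP.exists_unique_line hab
  refine ⟨{a, b}, card_pair hab, ?_⟩
  have hsub : PP.unsaturated {a, b} ⊆ ({p : Point | PP.Incid p l} : Finset Point)ᶜ := by
    intro x hx
    rw [mem_unsaturated] at hx
    simp only [mem_compl, mem_filter, mem_univ, true_and]
    exact fun hxl => hx (Or.inr ⟨l, hxl, a, by simp, b, by simp, hab, hal, hbl⟩)
  have h := card_le_card hsub
  rw [card_compl, PP.card_filter_incid, ← Nat.card_eq_fintype_card, PP.card_points] at h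
  omega

open Classical in
/-- If `l` meets `S` only in `s`, an unsaturated point `y` becomes saturated after adding
any of at least `|S| - 1` points of `l` other than `s`. -/
lemma le_card_saturating_points [Fintype Point] {S : Finset Point} {l : Line} {s y : Point}
    {k : ℕ} (hk : #S = k + 1) (hkq : k ≤ q) (hs : s ∈ S) (hsl : PP.Incid s l)
    (hl : ∀ t ∈ S, PP.Incid t l → t = s) (hy : ¬ PP.Saturated (S : Set Point) y) :
    k ≤ #{p ∈ ({p : Point | PP.Incid p l} : Finset Point).erase s |
      PP.Saturated (insert p S : Finset Point) y} := by
  have hyS : ∀ t ∈ S, t ≠ y := fun t ht h => hy (Or.inl (h ▸ ht))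
  have hline : ∀ (n : Line) (t u : Point), t ∈ S → u ∈ S → PP.Incid y n → PP.Incid t n →
      PP.Incid u n → t = u := by
    intro n t u ht hu hyn htn hun
    by_contra htu
    exact hy (Or.inr ⟨n, hyn, t, ht, u, hu, htu, htn, hun⟩)
  by_cases hyl : PP.Incid y l
  · rw [filter_true_of_mem, card_erase_of_mem (by simpa using hsl), PP.card_filter_incid]
    · simpa using hkq
    · intro p hp
      simp only [mem_erase, mem_filter, mem_univ, true_and] at hp
      exact Or.inr ⟨l, hyl, p, by simp, s, by simp [hs], hp.1, hp.2, hsl⟩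
  · have hex : ∀ t : Point, ∃ p : Point, t ∈ S.erase s →
        ∃ n : Line, PP.Incid y n ∧ PP.Incid t n ∧ PP.Incid p n ∧ PP.Incid p l := by
      intro t
      by_cases ht : t ∈ S.erase s
      · obtain ⟨n, ⟨htn, hyn⟩, -⟩ := PP.exists_unique_line (hyS t (mem_of_mem_erase ht))
        have hnl : n ≠ l := fun h => hyl (h ▸ hyn)
        obtain ⟨p, ⟨hpn, hpl⟩, -⟩ := PP.exists_unique_point hnl
        exact ⟨p, fun _ => ⟨n, hyn, htn, hpn, hpl⟩⟩
      · exact ⟨t, fun h => absurd h ht⟩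
    choose f hf using hex
    have hcard : #(S.erase s) = k := by rw [card_erase_of_mem hs, hk]; rfl
    rw [← hcard]
    refine card_le_card_of_injOn f ?_ ?_
    · intro t ht
      obtain ⟨n, hyn, htn, hpn, hpl⟩ := hf t ht
      have ht' := mem_erase.1 (mem_coe.1 ht)
      simp only [coe_filter, mem_erase, mem_filter, mem_univ, true_and, Set.mem_ofPred_eq]
      refine ⟨⟨fun h => ?_, hpl⟩, Or.inr ⟨n, hyn, f t, by simp, t, by simp [ht'.2], ?_, hpn, htn⟩⟩
      · exact ht'.1 (hline n t s ht'.2 hs hyn htn (h ▸ hpn))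
      · exact fun h => ht'.1 (hl t ht'.2 (h ▸ hpl))
    · intro t ht u hu htu
      obtain ⟨n, hyn, htn, hpn, hpl⟩ := hf t ht
      obtain ⟨n', hyn', hun', hpn', -⟩ := hf u hu
      have hne : y ≠ f t := fun h => hyl (h ▸ hpl)
      have hnn : n = n' := PP.incid_line_eq hne hyn hpn hyn' (htu ▸ hpn')
      exact hline n t u (mem_of_mem_erase ht) (mem_of_mem_erase hu) hyn htn (hnn ▸ hun')

open Classical in
lemma exists_insert_card_unsaturated_le [Fintype Point] (hq : 0 < q) {S : Finset Point} {k : ℕ}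
    (hk : #S = k + 1) (hkq : k ≤ q) (hS : (PP.unsaturated S).Nonempty) :
    ∃ T : Finset Point, #T = k + 2 ∧
      (#(PP.unsaturated T) : ℝ) ≤ #(PP.unsaturated S) * (1 - k / q) := by
  obtain ⟨x, hx⟩ := hS
  rw [mem_unsaturated] at hx
  obtain ⟨s, hs⟩ : S.Nonempty := card_pos.1 (by omega)
  have hsx : s ≠ x := fun h => hx (Or.inl (h ▸ hs))
  obtain ⟨l, ⟨hsl, hxl⟩, -⟩ := PP.exists_unique_line hsx
  have hl : ∀ t ∈ S, PP.Incid t l → t = s := by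
    intro t ht htl
    by_contra hts
    exact hx (Or.inr ⟨l, hxl, t, ht, s, hs, hts, htl, hsl⟩)
  set A := ({p : Point | PP.Incid p l} : Finset Point).erase s with hA
  have hAcard : #A = q := by
    rw [hA, card_erase_of_mem (by simpa using hsl), PP.card_filter_incid]; rfl
  have hsum : #(PP.unsaturated S) * k ≤
      ∑ p ∈ A, #{y ∈ PP.unsaturated S | PP.Saturated (insert p S : Finset Point) y} := by
    have := sum_card_bipartiteAbove_eq_sum_card_bipartiteBelow (s := A) (t := PP.unsaturated S)
      (fun p y => PP.Saturated (insert p S : Finset Point) y)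
    simp only [bipartiteAbove, bipartiteBelow] at this
    rw [this, ← smul_eq_mul]
    refine card_nsmul_le_sum _ _ _ fun y hy => ?_
    exact PP.le_card_saturating_points hk hkq hs hsl hl (PP.mem_unsaturated.1 hy)
  obtain ⟨p, hpA, hp⟩ : ∃ p ∈ A, #(PP.unsaturated S) * k ≤
      q * #{y ∈ PP.unsaturated S | PP.Saturated (insert p S : Finset Point) y} := by
    by_contra! h
    have hlt := sum_lt_sum_of_nonempty (card_pos.1 (by omega)) h
    rw [sum_const, hAcard, smul_eq_mul, ← mul_sum] at hlt
    exact absurd (Nat.mul_le_mul_left q hsum) (by omega)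
  have hp' : p ≠ s ∧ PP.Incid p l := by simpa [hA] using hpA
  refine ⟨insert p S, ?_, ?_⟩
  · rw [card_insert_of_notMem fun h => hp'.1 (hl p h hp'.2), hk]
  · have hsub : PP.unsaturated (insert p S) ⊆
        {y ∈ PP.unsaturated S | ¬ PP.Saturated (insert p S : Finset Point) y} := by
      intro y hy
      rw [mem_unsaturated] at hy
      refine mem_filter.2 ⟨PP.mem_unsaturated.2 fun h => hy ?_, hy⟩
      exact h.mono PP (by simp)
    have hle := card_le_card hsub
    have hadd := card_filter_add_card_filter_not (s := PP.unsaturated S)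
      (fun y => PP.Saturated (insert p S : Finset Point) y)
    have hq' : (0 : ℝ) < q := by exact_mod_cast hq
    have hle' : (#(PP.unsaturated (insert p S)) : ℝ) +
        #{y ∈ PP.unsaturated S | PP.Saturated (insert p S : Finset Point) y} ≤
        #(PP.unsaturated S) := by
      exact_mod_cast (by omega)
    have hp'' : (#(PP.unsaturated S) : ℝ) * k / q ≤
        #{y ∈ PP.unsaturated S | PP.Saturated (insert p S : Finset Point) y} := by
      rw [div_le_iff₀ hq']
      have : (#(PP.unsaturated S) : ℝ) * k ≤
        q * #{y ∈ PP.unsaturated S | PP.Saturated (insert p S : Finset Point) y} := by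
        exact_mod_cast hp
      linarith
    rw [mul_sub, mul_one, ← mul_div_assoc]
    linarith

lemma exists_saturatingSet_or_card_unsaturated_le [Fintype Point] (hq : 0 < q) (j : ℕ)
    (hj : j ≤ q) :
    (∃ S : Finset Point, #S ≤ j + 2 ∧ PP.SaturatingSet (S : Set Point)) ∨
      ∃ S : Finset Point, #S = j + 2 ∧
        (#(PP.unsaturated S) : ℝ) ≤ q ^ 2 * ∏ i ∈ range j, (1 - (i + 1) / q : ℝ) := by
  induction j with
  | zero =>
    obtain ⟨S, hS, hle⟩ := PP.exists_pair_card_unsaturated_le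
    exact Or.inr ⟨S, hS, by simpa using (by exact_mod_cast hle)⟩
  | succ j ih =>
    rcases ih (by omega) with ⟨S, hS, hsat⟩ | ⟨S, hS, hle⟩
    · exact Or.inl ⟨S, by omega, hsat⟩
    rcases (PP.unsaturated S).eq_empty_or_nonempty with h | h
    · refine Or.inl ⟨S, by omega, fun x => ?_⟩
      by_contra hx
      simpa [h] using PP.mem_unsaturated.2 hx
    · obtain ⟨T, hT, hTle⟩ := PP.exists_insert_card_unsaturated_le hq hS hj h
      refine Or.inr ⟨T, hT, hTle.trans ?_⟩
      rw [prod_range_succ, ← mul_assoc]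
      push_cast
      have hq' : (0 : ℝ) < q := by exact_mod_cast hq
      have hj' : (j : ℝ) + 1 ≤ q := by exact_mod_cast hj
      exact mul_le_mul_of_nonneg_right hle (sub_nonneg.2 ((div_le_one hq').2 hj'))

lemma exists_saturatingSet_of_prod_lt_one (hq : 0 < q) (j : ℕ) (hj : j ≤ q)
    (h : (q : ℝ) ^ 2 * ∏ i ∈ range j, (1 - (i + 1) / q : ℝ) < 1) :
    ∃ S : Set Point, PP.SaturatingSet S ∧ S.ncard ≤ j + 2 := by
  have := PP.finite_point
  have := Fintype.ofFinite Point
  rcases PP.exists_saturatingSet_or_card_unsaturated_le hq j hj with ⟨S, hS, hsat⟩ | ⟨S, hS, hle⟩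
  · exact ⟨S, hsat, by simpa using hS⟩
  · refine ⟨S, fun x => ?_, by simp [hS]⟩
    have h0 : #(PP.unsaturated S) < 1 := by exact_mod_cast hle.trans_lt h
    by_contra hx
    have := card_pos.2 ⟨x, PP.mem_unsaturated.2 hx⟩
    omega

end ProjPlane

lemma Real.one_sub_le_exp_neg_add_sq {x : ℝ} (h0 : 0 ≤ x) (h1 : x < 1) :
    1 - x ≤ Real.exp (-(x + x ^ 2 / 2)) := by
  have h := Real.hasSum_pow_div_log_of_abs_lt_one (abs_lt.2 ⟨by linarith, h1⟩)
  have h2 := sum_le_hasSum (Finset.range 2) (fun i _ => by positivity) h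
  simp only [Finset.sum_range_succ, Finset.sum_range_zero] at h2
  norm_num at h2
  rw [← Real.log_le_iff_le_exp (by linarith)]
  linarith

lemma sum_range_div_add_sq (q : ℝ) (m : ℕ) :
    ∑ i ∈ Finset.range m, (((i : ℝ) + 1) / q + (((i : ℝ) + 1) / q) ^ 2 / 2) =
      (m : ℝ) * (m + 1) / (2 * q) + m * (m + 1) * (2 * m + 1) / (12 * q ^ 2) := by
  induction m with
  | zero => simp
  | succ m ih =>
    rw [Finset.sum_range_succ, ih]
    by_cases hq : q = 0
    · simp [hq]
    · push_cast
      field_simp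
      ring

lemma sq_mul_prod_one_sub_lt_one {q m : ℕ} (hq : 2 ≤ q) (hm : m < q) {M : ℝ} (hM0 : 0 ≤ M)
    (hM : M ^ 2 = 4 * (q + 1) * Real.log (q + 1)) (hmM : M - 1 ≤ m) (hMq : M < q) :
    (q : ℝ) ^ 2 * ∏ i ∈ Finset.range m, (1 - (i + 1) / q : ℝ) < 1 := by
  have hq2 : (2 : ℝ) ≤ q := by exact_mod_cast hq
  have hq0 : (0 : ℝ) < q := by linarith
  have hlog1 : 1 ≤ Real.log (q + 1) := by
    rw [Real.le_log_iff_exp_le (by linarith)]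
    linarith [Real.exp_one_lt_d9]
  have hq4 : (4 : ℝ) ≤ q := by nlinarith
  have hlog : 3 / 2 ≤ Real.log (q + 1) := by
    rw [Real.le_log_iff_exp_le (by linarith)]
    have h1 := Real.exp_one_lt_d9
    have h2 : Real.exp (3 / 2) ^ 2 = Real.exp 1 ^ 3 := by
      rw [← Real.exp_nat_mul, ← Real.exp_nat_mul]; norm_num
    have h3 : Real.exp 1 ^ 3 ≤ 2.72 ^ 3 := by gcongr; linarith
    nlinarith [Real.exp_pos (3 / 2)]
  have hlogq : Real.log q < Real.log (q + 1) := Real.log_lt_log hq0 (by linarith)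
  have hM6 : 6 * ((q : ℝ) + 1) ≤ M ^ 2 := by nlinarith
  have hM5 : 5 ≤ M := by nlinarith
  have hkey : 6 * q ≤ (2 * M - 1) * (M - 1) := by nlinarith
  have hprod : ∏ i ∈ Finset.range m, (1 - (i + 1) / q : ℝ) ≤
      Real.exp (-((m : ℝ) * (m + 1) / (2 * q) + m * (m + 1) * (2 * m + 1) / (12 * q ^ 2))) := by
    rw [← sum_range_div_add_sq, ← Finset.sum_neg_distrib, Real.exp_sum]
    have hlt : ∀ i ∈ Finset.range m, ((i : ℝ) + 1) / q < 1 := by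
      intro i hi
      rw [div_lt_one hq0]
      have : i + 1 < q := by have := Finset.mem_range.1 hi; omega
      exact_mod_cast this
    refine Finset.prod_le_prod (fun i hi => by linarith [hlt i hi]) fun i hi => ?_
    exact Real.one_sub_le_exp_neg_add_sq (by positivity) (hlt i hi)
  have hA : M * (M - 1) ≤ m * (m + 1) := by nlinarith
  have hB : M * (M - 1) * (6 * q + (2 * M - 1)) ≤ m * (m + 1) * (6 * q + (2 * m + 1)) := by
    gcongr
    · nlinarith
    · linarith
  have hC : M ^ 2 * (6 * q) ≤ M * (M - 1) * (6 * q + (2 * M - 1)) := by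
    nlinarith [mul_le_mul_of_nonneg_left hkey hM0]
  have hD : 24 * (q : ℝ) ^ 2 * Real.log q < M ^ 2 * (6 * q) := by
    rw [hM]
    nlinarith [mul_lt_mul_of_pos_left hlogq (by positivity : (0 : ℝ) < 24 * q ^ 2),
      mul_pos hq0 (by linarith : 0 < Real.log (q + 1))]
  have hE : 2 * Real.log q <
      (m : ℝ) * (m + 1) / (2 * q) + m * (m + 1) * (2 * m + 1) / (12 * q ^ 2) := by
    have : (m : ℝ) * (m + 1) / (2 * q) + m * (m + 1) * (2 * m + 1) / (12 * q ^ 2) =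
        m * (m + 1) * (6 * q + (2 * m + 1)) / (12 * q ^ 2) := by
      field_simp
      ring
    rw [this, lt_div_iff₀ (by positivity)]
    linarith
  have hqexp : (q : ℝ) ^ 2 = Real.exp (2 * Real.log q) := by
    rw [two_mul, Real.exp_add, Real.exp_log hq0, sq]
  calc (q : ℝ) ^ 2 * ∏ i ∈ Finset.range m, (1 - (i + 1) / q : ℝ)
      ≤ q ^ 2 * Real.exp (-((m : ℝ) * (m + 1) / (2 * q) +
          m * (m + 1) * (2 * m + 1) / (12 * q ^ 2))) := by gcongr
    _ < 1 := by
      nth_rewrite 1 [hqexp]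
      rw [← Real.exp_add, Real.exp_lt_one_iff]
      linarith

/-- In any finite projective plane of order q ≥ 2 there is a saturating set of
size at most √(4(q+1)·ln(q+1)) + 2. -/
theorem exists_saturating_set_Bartoli {Point Line : Type*} {q : ℕ} (hq : 2 ≤ q)
    (PP : ProjPlane Point Line q) :
    ∃ S : Set Point, PP.SaturatingSet S ∧
      (S.ncard : ℝ) ≤ Real.sqrt (4 * (q + 1) * Real.log (q + 1)) + 2 := by
  set M := Real.sqrt (4 * (q + 1) * Real.log (q + 1)) with hMdef
  have hM0 : 0 ≤ M := Real.sqrt_nonneg _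
  have hM : M ^ 2 = 4 * (q + 1) * Real.log (q + 1) :=
    Real.sq_sqrt (mul_nonneg (by positivity) (Real.log_nonneg (by simp)))
  obtain ⟨j, hj, hjM, hprod⟩ : ∃ j ≤ q, (j : ℝ) ≤ M ∧
      (q : ℝ) ^ 2 * ∏ i ∈ Finset.range j, (1 - (i + 1) / q : ℝ) < 1 := by
    rcases le_or_gt (q : ℝ) M with h | h
    · refine ⟨q, le_rfl, h, ?_⟩
      rw [Finset.prod_eq_zero (i := q - 1) (Finset.mem_range.2 (by omega))]
      · simp
      · have hq0 : (q : ℝ) ≠ 0 := by exact_mod_cast (by omega : q ≠ 0)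
        rw [Nat.cast_sub (by omega)]
        simp [hq0]
    · have hlt : ⌊M⌋₊ < q := (Nat.floor_lt hM0).2 h
      exact ⟨⌊M⌋₊, hlt.le, Nat.floor_le hM0,
        sq_mul_prod_one_sub_lt_one hq hlt hM0 hM (Nat.sub_one_lt_floor M).le h⟩
  obtain ⟨S, hS, hcard⟩ := PP.exists_saturatingSet_of_prod_lt_one (by omega) j hj hprod
  refine ⟨S, hS, ?_⟩
  have : (S.ncard : ℝ) ≤ j + 2 := by exact_mod_cast hcard
  linarith
end

section
/- Let S* be a set of points of a finite projective plane Π_q of order q ≥ 2 with |S*| ≥ 2, and let R be the set of points of Π_q that are not in S* and are not saturated by S*. Then there exists a set T of points with |T| ≤ ⌈|R|/2⌉ such that S* ∪ T is a saturating set of Π_q. -/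
/-- If every two elements of `R` are jointly covered by one element, then `⌈#R / 2⌉` elements
suffice to cover `R`. -/
theorem Finset.exists_cover_card_le_half {α β : Type*} (cov : β → α → Prop) (R : Finset α)
    (h : ∀ a ∈ R, ∀ b ∈ R, ∃ p, cov p a ∧ cov p b) :
    ∃ T : Finset β, T.card ≤ (R.card + 1) / 2 ∧ ∀ a ∈ R, ∃ p ∈ T, cov p a := by
  classical
  induction R using Finset.strongInduction with
  | H R ih =>
    rcases R.eq_empty_or_nonempty with rfl | ⟨a, ha⟩
    · exact ⟨∅, by simp⟩
    rcases (R.erase a).eq_empty_or_nonempty with hR | ⟨b, hb⟩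
    · obtain ⟨p, hp, -⟩ := h a ha a ha
      refine ⟨{p}, ?_, fun x hx => ⟨p, Finset.mem_singleton_self p, ?_⟩⟩
      · have := Finset.card_pos.2 ⟨a, ha⟩
        rw [Finset.card_singleton]
        omega
      · rcases (Finset.erase_eq_empty_iff R a).1 hR with rfl | rfl
        · simp at ha
        · rwa [Finset.mem_singleton.1 hx]
    · obtain ⟨p, hpa, hpb⟩ := h a ha b (Finset.mem_of_mem_erase hb)
      have hsub : (R.erase a).erase b ⊆ R :=
        (Finset.erase_subset _ _).trans (Finset.erase_subset _ _)
      obtain ⟨T, hT, hcov⟩ := ih ((R.erase a).erase b)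
        ((Finset.erase_subset _ _).trans_ssubset (Finset.erase_ssubset ha))
        fun x hx y hy => h x (hsub hx) y (hsub hy)
      refine ⟨insert p T, ?_, fun x hx => ?_⟩
      · have h₁ := Finset.card_erase_add_one ha
        have h₂ := Finset.card_erase_add_one hb
        have h₃ := Finset.card_insert_le p T
        omega
      · by_cases hxa : x = a
        · exact ⟨p, Finset.mem_insert_self p T, hxa ▸ hpa⟩
        by_cases hxb : x = b
        · exact ⟨p, Finset.mem_insert_self p T, hxb ▸ hpb⟩
        obtain ⟨r, hr, hrx⟩ := hcov x (by simp [hx, hxa, hxb])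
        exact ⟨r, Finset.mem_insert_of_mem hr, hrx⟩

theorem ProjPlane.Saturated.mono_s4 {Point Line : Type*} {q : ℕ} {PP : ProjPlane Point Line q}
    {S S' : Set Point} {x : Point} (hx : PP.Saturated S x) (hS : S ⊆ S') : PP.Saturated S' x := by
  rcases hx with hx | ⟨l, hxl, a, ha, b, hb, hab⟩
  · exact Or.inl (hS hx)
  · exact Or.inr ⟨l, hxl, a, hS ha, b, hS hb, hab⟩

/-- Any two points unsaturated by `S` become saturated after adding one suitable point to `S`:
the intersection of the lines joining them to two distinct points of `S`. -/
theorem ProjPlane.exists_saturated_insert {Point Line : Type*} {q : ℕ}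
    (PP : ProjPlane Point Line q) {S : Set Point} (hS : S.Nontrivial) {x y : Point}
    (hx : ¬ PP.Saturated S x) (hy : ¬ PP.Saturated S y) :
    ∃ p, PP.Saturated (insert p S) x ∧ PP.Saturated (insert p S) y := by
  obtain ⟨s, hs, t, ht, hst⟩ := hS
  have hxs : x ≠ s := fun h => hx (Or.inl (h ▸ hs))
  have hyt : y ≠ t := fun h => hy (Or.inl (h ▸ ht))
  obtain ⟨l, hxl, hsl⟩ := (PP.exists_unique_line hxs).exists
  obtain ⟨m, hym, htm⟩ := (PP.exists_unique_line hyt).exists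
  have htl : ¬ PP.Incid t l := fun h => hx (Or.inr ⟨l, hxl, s, hs, t, ht, hst, hsl, h⟩)
  have hsm : ¬ PP.Incid s m := fun h => hy (Or.inr ⟨m, hym, s, hs, t, ht, hst, h, htm⟩)
  have hlm : l ≠ m := fun h => htl (h ▸ htm)
  obtain ⟨p, hpl, hpm⟩ := (PP.exists_unique_point hlm).exists
  have hps : p ≠ s := fun h => hsm (h ▸ hpm)
  have hpt : p ≠ t := fun h => htl (h ▸ hpl)
  exact ⟨p,
    Or.inr ⟨l, hxl, p, Set.mem_insert p S, s, Set.mem_insert_of_mem p hs, hps, hpl, hsl⟩,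
    Or.inr ⟨m, hym, p, Set.mem_insert p S, t, Set.mem_insert_of_mem p ht, hpt, hpm, htm⟩⟩

/-- Completion lemma: if R is the set of points outside S* not saturated by
S*, one can add at most ⌈|R|/2⌉ points to S* to obtain a saturating set. -/
theorem completion_lemma {Point Line : Type*} {q : ℕ} (hq : 2 ≤ q)
    (PP : ProjPlane Point Line q) (S : Set Point) (hScard : 2 ≤ S.ncard)
    (R : Set Point) (hR : R = {x : Point | x ∉ S ∧ ¬ PP.Saturated S x}) :
    ∃ T : Set Point, T.ncard ≤ ⌈(R.ncard : ℝ) / 2⌉₊ ∧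
      PP.SaturatingSet (S ∪ T) := by
  classical
  have : Finite Point := Nat.finite_of_card_ne_zero (by rw [PP.card_points]; omega)
  have hS : S.Nontrivial := Set.one_lt_ncard_iff_nontrivial.1 hScard
  have hfin : R.Finite := R.toFinite
  have hmem : ∀ x, x ∈ hfin.toFinset ↔ ¬ PP.Saturated S x := by
    intro x
    rw [Set.Finite.mem_toFinset, hR]
    exact ⟨fun h => h.2, fun h => ⟨fun hx => h (Or.inl hx), h⟩⟩
  obtain ⟨T, hT, hcov⟩ := Finset.exists_cover_card_le_half
    (fun p x => PP.Saturated (insert p S) x) hfin.toFinset fun x hx y hy =>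
      PP.exists_saturated_insert hS ((hmem x).1 hx) ((hmem y).1 hy)
  refine ⟨T, ?_, fun x => ?_⟩
  · rw [Set.ncard_coe_finset]
    rw [← Set.ncard_eq_toFinset_card R hfin] at hT
    have hceil : (R.ncard : ℝ) ≤ 2 * (⌈(R.ncard : ℝ) / 2⌉₊ : ℝ) := by
      linarith [Nat.le_ceil ((R.ncard : ℝ) / 2)]
    have hceil' : R.ncard ≤ 2 * ⌈(R.ncard : ℝ) / 2⌉₊ := by exact_mod_cast hceil
    omega
  · by_cases hx : PP.Saturated S x
    · exact hx.mono_s4 Set.subset_union_left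
    · obtain ⟨p, hp, hpx⟩ := hcov x ((hmem x).2 hx)
      exact hpx.mono_s4 (Set.insert_subset (Or.inr hp) Set.subset_union_left)
end

section
/- Let S be a set of i points in a finite projective plane Π_q of order q ≥ 2 with i ≤ q, and let R be the set of points of Π_q that are not in S and are not saturated by S. Then there exists a line ℓ skew to S with q·|R ∩ ℓ| ≤ |R| (i.e., |R ∩ ℓ| ≤ |R|/q). -/
namespace ProjPlane

variable {Point Line : Type*} {q : ℕ}

open scoped Classical in
/-- The pencil of lines through a point has `q + 1` elements. -/
theorem card_pencil [Fintype Line] (PP : ProjPlane Point Line q) (p : Point) :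
    (Finset.univ.filter fun l => PP.Incid p l).card = q + 1 := by
  rw [← PP.card_point_lines p, Nat.card_eq_fintype_card, Fintype.card_subtype]

open scoped Classical in
/-- At most `|T| q + 1` lines meet a finite point set `T`. -/
theorem card_lines_meeting_le [Fintype Line] (PP : ProjPlane Point Line q) (T : Finset Point) :
    (Finset.univ.filter fun l => ∃ p ∈ T, PP.Incid p l).card ≤ T.card * q + 1 := by
  induction T using Finset.induction_on with
  | empty => simp
  | insert a T ha ih =>
    rw [Finset.card_insert_of_notMem ha]
    rcases T.eq_empty_or_nonempty with rfl | ⟨b, hb⟩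
    · simp [PP.card_pencil a]
    · have hab : a ≠ b := fun h => ha (h ▸ hb)
      obtain ⟨m, ⟨ham, hbm⟩, -⟩ := PP.exists_unique_line hab
      have hsub : (Finset.univ.filter fun l => ∃ p ∈ insert a T, PP.Incid p l) ⊆
          (Finset.univ.filter fun l => ∃ p ∈ T, PP.Incid p l) ∪
            (Finset.univ.filter fun l => PP.Incid a l).erase m := by
        intro l hl
        obtain ⟨p, hp, hpl⟩ := (Finset.mem_filter.1 hl).2
        simp only [Finset.mem_union, Finset.mem_filter, Finset.mem_univ, true_and,
          Finset.mem_erase]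
        rcases Finset.mem_insert.1 hp with rfl | hp
        · by_cases hlm : l = m
          · exact Or.inl ⟨b, hb, hlm ▸ hbm⟩
          · exact Or.inr ⟨hlm, hpl⟩
        · exact Or.inl ⟨p, hp, hpl⟩
      have hcard : ((Finset.univ.filter fun l => PP.Incid a l).erase m).card = q := by
        rw [Finset.card_erase_of_mem (by simpa using ham), PP.card_pencil a, Nat.add_sub_cancel]
      have hle := (Finset.card_le_card hsub).trans (Finset.card_union_le _ _)
      rw [hcard] at hle
      linarith

open scoped Classical in
/-- Through a point not saturated by `T` there pass at most `q + 1 - |T|` lines skew to `T`. -/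
theorem card_skew_pencil_add_card_le [Fintype Line] (PP : ProjPlane Point Line q)
    (T : Finset Point) {x : Point} (hx : ¬ PP.Saturated (T : Set Point) x) :
    (Finset.univ.filter fun l => (∀ p ∈ T, ¬ PP.Incid p l) ∧ PP.Incid x l).card + T.card
      ≤ q + 1 := by
  have hne : ∀ p ∈ T, p ≠ x := by
    rintro p hp rfl
    exact hx (Or.inl hp)
  have hjoin : ∀ p ∈ T, ∃ l, PP.Incid p l ∧ PP.Incid x l :=
    fun p hp => (PP.exists_unique_line (hne p hp)).exists
  have hline : Nonempty Line := by
    obtain ⟨a, b, -, -, hab, -⟩ := PP.nondegenerate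
    exact (PP.exists_unique_line hab).exists.nonempty
  choose! f hf using hjoin
  have hinj : Set.InjOn f (T : Set Point) := by
    intro a ha b hb hab
    by_contra h
    exact hx (Or.inr ⟨f a, (hf a ha).2, a, ha, b, hb, h, (hf a ha).1, hab ▸ (hf b hb).1⟩)
  rw [← Finset.card_image_of_injOn hinj, ← PP.card_pencil x, ← Finset.card_union_of_disjoint]
  · refine Finset.card_le_card fun l hl => ?_
    rcases Finset.mem_union.1 hl with hl | hl
    · simpa using (Finset.mem_filter.1 hl).2.2
    · obtain ⟨p, hp, rfl⟩ := Finset.mem_image.1 hl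
      simpa using (hf p hp).2
  · refine Finset.disjoint_left.2 fun l hl hl' => ?_
    obtain ⟨p, hp, rfl⟩ := Finset.mem_image.1 hl'
    exact (Finset.mem_filter.1 hl).2.1 p hp (hf p hp).1

end ProjPlane

/-- There is a line skew to S meeting R in at most |R|/q points. -/
theorem exists_skew_line_small_intersection {Point Line : Type*} {q i : ℕ}
    (hq : 2 ≤ q) (PP : ProjPlane Point Line q) (S : Set Point)
    (hScard : S.ncard = i) (hiq : i ≤ q)
    (R : Set Point) (hR : R = {x : Point | x ∉ S ∧ ¬ PP.Saturated S x}) :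
    ∃ l : Line, (∀ p ∈ S, ¬ PP.Incid p l) ∧
      q * (R ∩ {x : Point | PP.Incid x l}).ncard ≤ R.ncard := by
  classical
  have : Finite Point := Nat.finite_of_card_ne_zero (by rw [PP.card_points]; omega)
  have : Finite Line := Nat.finite_of_card_ne_zero (by rw [PP.card_lines]; omega)
  have := Fintype.ofFinite Point
  have := Fintype.ofFinite Line
  obtain ⟨T, rfl⟩ := S.toFinite.exists_finset_coe
  obtain ⟨U, rfl⟩ := R.toFinite.exists_finset_coe
  have hU : ∀ x ∈ U, ¬ PP.Saturated (T : Set Point) x := fun x hx =>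
    (hR.subset (Finset.mem_coe.2 hx)).2
  rw [Set.ncard_coe_finset] at hScard
  subst hScard
  obtain ⟨k, hk⟩ : ∃ k, q + 1 = T.card + k := ⟨q + 1 - T.card, by omega⟩
  set N := Finset.univ.filter fun l => ∀ p ∈ T, ¬ PP.Incid p l with hN
  have hNcard : q * k ≤ N.card := by
    have hsplit := Finset.card_filter_add_card_filter_not (s := (Finset.univ : Finset Line))
      fun l => ∃ p ∈ T, PP.Incid p l
    have hmeet := PP.card_lines_meeting_le T
    have hskew : (Finset.univ.filter fun l => ¬ ∃ p ∈ T, PP.Incid p l) = N := by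
      ext l; simp [hN]
    rw [hskew, Finset.card_univ, ← Nat.card_eq_fintype_card, PP.card_lines] at hsplit
    nlinarith
  have hsum : ∑ l ∈ N, (U.filter fun x => PP.Incid x l).card ≤ U.card * k := by
    have hswap := Finset.sum_card_bipartiteAbove_eq_sum_card_bipartiteBelow
      (s := U) (t := N) PP.Incid
    simp only [Finset.bipartiteAbove, Finset.bipartiteBelow] at hswap
    rw [← hswap, ← smul_eq_mul]
    refine Finset.sum_le_card_nsmul _ _ _ fun x hx => ?_
    have h := (Nat.le_sub_of_add_le (PP.card_skew_pencil_add_card_le T (hU x hx))).trans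
      (show q + 1 - T.card ≤ k by omega)
    rw [hN, Finset.filter_filter]
    convert h
  by_contra! hcon
  have hlarge : ∀ l ∈ N, U.card + 1 ≤ q * (U.filter fun x => PP.Incid x l).card := by
    intro l hl
    have h := hcon l (Finset.mem_filter.1 hl).2
    have hset : (U : Set Point) ∩ {x | PP.Incid x l} =
        ((U.filter fun x => PP.Incid x l : Finset Point) : Set Point) := by
      ext x; simp
    rwa [hset, Set.ncard_coe_finset, Set.ncard_coe_finset] at h
  have hlower := Finset.card_nsmul_le_sum N _ _ hlarge
  rw [← Finset.mul_sum, smul_eq_mul] at hlower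
  have h₁ := Nat.mul_le_mul_right (U.card + 1) hNcard
  have h₂ := Nat.mul_le_mul_left q hsum
  have h₃ : 0 < q * k := Nat.mul_pos (by omega) (by omega)
  nlinarith
end

section
/- Let S be a set of i points, i ≥ 1, in a finite projective plane Π_q of order q ≥ 2, let R be the set of points of Π_q that are not in S and are not saturated by S, and let ℓ be a line skew to S. For a point P ∉ S define the benefit b(P) as the number of points x ∈ R for which some line contains x, P and a point of S distinct from P. Then Σ_{P ∈ ℓ} b(P) = |R ∩ ℓ| + i·|R \ ℓ|. -/
/-- `x` lies on a line through `P` and a point of `S` distinct from `P`. -/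
def ProjPlane.OnSecantThrough {Point Line : Type*} {q : ℕ}
    (PP : ProjPlane Point Line q) (S : Set Point) (P x : Point) : Prop :=
  ∃ m : Line, PP.Incid x m ∧ PP.Incid P m ∧ ∃ s ∈ S, s ≠ P ∧ PP.Incid s m

theorem ProjPlane.line_eq_s9 {Point Line : Type*} {q : ℕ} (PP : ProjPlane Point Line q)
    {a b : Point} (hab : a ≠ b) {l m : Line} (hal : PP.Incid a l) (hbl : PP.Incid b l)
    (ham : PP.Incid a m) (hbm : PP.Incid b m) : l = m :=
  (PP.exists_unique_line hab).unique ⟨hal, hbl⟩ ⟨ham, hbm⟩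

/-- A point on a line skew to `S` is seen, through points of `S`, only from itself among the
points of that line. -/
theorem ProjPlane.setOf_onSecantThrough_of_mem {Point Line : Type*} {q : ℕ}
    (PP : ProjPlane Point Line q) {S : Set Point} (hS : S.Nonempty) {l : Line}
    (hl : ∀ p ∈ S, ¬ PP.Incid p l) {x : Point} (hx : PP.Incid x l) :
    {P : Point | PP.Incid P l ∧ PP.OnSecantThrough S P x} = {x} := by
  ext P
  constructor
  · rintro ⟨hP, m, hxm, hPm, s, hs, -, hsm⟩
    by_contra hne
    exact hl s hs (PP.line_eq_s9 hne hPm hxm hP hx ▸ hsm)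
  · rintro rfl
    obtain ⟨s, hs⟩ := hS
    have hsP : s ≠ P := fun h => hl s hs (h ▸ hx)
    obtain ⟨m, ⟨hsm, hPm⟩, -⟩ := PP.exists_unique_line hsP
    exact ⟨hx, m, hPm, hPm, s, hs, hsP, hsm⟩

/-- Projecting `S` from a non-saturated point `x` onto a line skew to `S` that misses `x` is
injective. -/
theorem ProjPlane.ncard_setOf_onSecantThrough {Point Line : Type*} {q : ℕ}
    (PP : ProjPlane Point Line q) {S : Set Point} {l : Line}
    (hl : ∀ p ∈ S, ¬ PP.Incid p l) {x : Point} (hx : ¬ PP.Incid x l)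
    (hxS : ¬ PP.Saturated S x) :
    {P : Point | PP.Incid P l ∧ PP.OnSecantThrough S P x}.ncard = S.ncard := by
  have key : ∀ s ∈ S, ∃ P, ∃ m, PP.Incid P l ∧ PP.Incid P m ∧ PP.Incid x m ∧ PP.Incid s m := by
    intro s hs
    have hsx : s ≠ x := fun h => hxS (Or.inl (h ▸ hs))
    obtain ⟨m, ⟨hsm, hxm⟩, -⟩ := PP.exists_unique_line hsx
    have hml : m ≠ l := fun h => hx (h ▸ hxm)
    obtain ⟨P, ⟨hPm, hPl⟩, -⟩ := PP.exists_unique_point hml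
    exact ⟨P, m, hPl, hPm, hxm, hsm⟩
  choose f m hfl hfm hxm hsm using key
  have hne : ∀ {P}, PP.Incid P l → P ≠ x := fun hP h => hx (h ▸ hP)
  symm
  refine Set.ncard_congr f (fun s hs => ?_) (fun a b ha hb hab => ?_) (fun P hP => ?_)
  · exact ⟨hfl s hs, m s hs, hxm s hs, hfm s hs, s, hs, fun h => hl s hs (h ▸ hfl s hs),
      hsm s hs⟩
  · by_contra hne'
    have hm : m a ha = m b hb :=
      PP.line_eq_s9 (hne (hfl a ha)) (hfm a ha) (hxm a ha) (hab ▸ hfm b hb) (hxm b hb)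
    exact hxS (Or.inr ⟨m a ha, hxm a ha, a, ha, b, hb, hne', hsm a ha, hm ▸ hsm b hb⟩)
  · obtain ⟨hPl, k, hxk, hPk, s, hs, -, hsk⟩ := hP
    have hsx : s ≠ x := fun h => hxS (Or.inl (h ▸ hs))
    have hk : m s hs = k := PP.line_eq_s9 hsx (hsm s hs) (hxm s hs) hsk hxk
    have hkl : k ≠ l := fun h => hx (h ▸ hxk)
    exact ⟨s, hs, (PP.exists_unique_point hkl).unique ⟨hk ▸ hfm s hs, hfl s hs⟩ ⟨hPk, hPl⟩⟩

open scoped Classical in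
/-- Double counting of the pairs of a relation between a finset and a set. -/
theorem Finset.sum_ncard_setOf_mem_and {α β : Type*} [Fintype α] [Fintype β]
    (p : α → Prop) (R : Set β) (r : α → β → Prop) :
    ∑ a ∈ Finset.univ.filter p, {b | b ∈ R ∧ r a b}.ncard
      = ∑ b ∈ Finset.univ.filter (· ∈ R), {a | p a ∧ r a b}.ncard := by
  have h := Finset.sum_card_bipartiteAbove_eq_sum_card_bipartiteBelow r
    (s := Finset.univ.filter p) (t := Finset.univ.filter (· ∈ R))
  simpa only [Finset.bipartiteAbove, Finset.bipartiteBelow, Finset.filter_filter,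
    Set.ncard_eq_toFinset_card', Set.toFinset_ofPred] using h

open scoped Classical in
/-- For a line ℓ skew to S, the sum of the benefits of the points of ℓ equals
|R ∩ ℓ| + i·|R \ ℓ|, where the benefit of P ∉ S is the number of x ∈ R lying
on some line through P and a point of S distinct from P. -/
theorem benefit_sum_on_skew_line {Point Line : Type*} [Fintype Point] [Fintype Line]
    {q i : ℕ} (hq : 2 ≤ q) (PP : ProjPlane Point Line q) (S : Set Point)
    (hScard : S.ncard = i) (hi : 1 ≤ i)
    (R : Set Point) (hR : R = {x : Point | x ∉ S ∧ ¬ PP.Saturated S x})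
    (l : Line) (hl : ∀ p ∈ S, ¬ PP.Incid p l) :
    ∑ P ∈ Finset.univ.filter (fun P : Point => PP.Incid P l),
        {x : Point | x ∈ R ∧ ∃ m : Line, PP.Incid x m ∧ PP.Incid P m ∧
          ∃ s ∈ S, s ≠ P ∧ PP.Incid s m}.ncard
      = (R ∩ {x : Point | PP.Incid x l}).ncard
          + i * (R \ {x : Point | PP.Incid x l}).ncard := by
  have hS : S.Nonempty := by
    rw [← Set.ncard_pos]
    omega
  have hRS : ∀ x ∈ R, ¬ PP.Saturated S x := by
    rw [hR]
    exact fun x hx => hx.2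
  have hcount : ∀ x ∈ Finset.univ.filter (· ∈ R),
      {P : Point | PP.Incid P l ∧ PP.OnSecantThrough S P x}.ncard
        = if PP.Incid x l then 1 else i := by
    intro x hx
    split_ifs with hxl
    · rw [PP.setOf_onSecantThrough_of_mem hS hl hxl, Set.ncard_singleton]
    · rw [PP.ncard_setOf_onSecantThrough hl hxl (hRS x (Finset.mem_filter.mp hx).2), hScard]
  refine (Finset.sum_ncard_setOf_mem_and _ R (PP.OnSecantThrough S)).trans ?_
  rw [Finset.sum_congr rfl hcount, Finset.sum_ite, Finset.sum_const, Finset.sum_const,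
    Finset.filter_filter, Finset.filter_filter, smul_eq_mul, smul_eq_mul, mul_one, mul_comm,
    Set.ncard_eq_toFinset_card', Set.ncard_eq_toFinset_card']
  congr 3 <;> ext x <;> simp
end

section
/- There exists q₀ such that for every integer q ≥ q₀, setting k = ⌈√(3q·ln q)⌉, the real product Π_{i=1}^{k} (1 − i/(q+2)) is strictly less than q^{−3/2}. -/
theorem twelve_mul_log_lt {x : ℝ} (hx : 576 ≤ x) : 12 * Real.log x < x := by
  have hs : 24 ≤ √x := Real.le_sqrt_of_sq_le (by linarith)
  have hsq : √x ^ 2 = x := Real.sq_sqrt (by linarith)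
  have hlog : Real.log √x ≤ √x - 1 := Real.log_le_sub_one_of_pos (by linarith)
  rw [Real.log_sqrt (by linarith)] at hlog
  nlinarith

theorem sum_Icc_one_cast (k : ℕ) : ∑ i ∈ Finset.Icc 1 k, (i : ℝ) = k * (k + 1) / 2 := by
  induction k with
  | zero => simp
  | succ n ih =>
    rw [Finset.sum_Icc_succ_top (by omega), ih]
    push_cast
    ring

theorem prod_one_sub_div_le_exp {n : ℝ} (hn : 0 < n) {k : ℕ} (hk : (k : ℝ) ≤ n) :
    ∏ i ∈ Finset.Icc 1 k, (1 - (i : ℝ) / n) ≤ Real.exp (-(k * (k + 1) / (2 * n))) := by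
  calc ∏ i ∈ Finset.Icc 1 k, (1 - (i : ℝ) / n)
      ≤ ∏ i ∈ Finset.Icc 1 k, Real.exp (-((i : ℝ) / n)) := by
        refine Finset.prod_le_prod (fun i hi => ?_) fun i _ => Real.one_sub_le_exp_neg _
        have hik : (i : ℝ) ≤ k := by exact_mod_cast (Finset.mem_Icc.mp hi).2
        rw [sub_nonneg, div_le_one hn]
        exact hik.trans hk
    _ = Real.exp (-(k * (k + 1) / (2 * n))) := by
        rw [← Real.exp_sum, Finset.sum_neg_distrib, ← Finset.sum_div, sum_Icc_one_cast, div_div]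

/-- For all sufficiently large q, with k = ⌈√(3q·ln q)⌉, the product
∏_{i=1}^{k} (1 − i/(q+2)) is strictly less than q^{−3/2}. -/
theorem product_bound :
    ∃ q₀ : ℕ, ∀ q : ℕ, q₀ ≤ q →
      ∏ i ∈ Finset.Icc 1 ⌈Real.sqrt (3 * q * Real.log q)⌉₊,
          (1 - (i : ℝ) / ((q : ℝ) + 2))
        < (q : ℝ) ^ (-(3 : ℝ) / 2) := by
  refine ⟨576, fun q hq => ?_⟩
  have hq' : (576 : ℝ) ≤ q := by exact_mod_cast hq
  have hlog := twelve_mul_log_lt hq'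
  have hpos : 0 < Real.log q := Real.log_pos (by linarith)
  set L := Real.log q with hL
  set s := √(3 * q * L) with hs
  have hs_sq : s ^ 2 = 3 * q * L := Real.sq_sqrt (by positivity)
  have hs_le : s ≤ q := Real.sqrt_le_iff.mpr ⟨by linarith, by nlinarith⟩
  have hs_gt : 6 * L < s := Real.lt_sqrt_of_sq_lt (by nlinarith)
  have hk_ge : s ≤ ⌈s⌉₊ := Nat.le_ceil s
  have hk_le : (⌈s⌉₊ : ℝ) ≤ q + 2 := by
    have := Nat.ceil_lt_add_one (Real.sqrt_nonneg (3 * q * L))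
    linarith
  refine (prod_one_sub_div_le_exp (by linarith) hk_le).trans_lt ?_
  rw [Real.rpow_def_of_pos (by linarith), Real.exp_lt_exp, ← hL]
  have key : L * (3 / 2) < ⌈s⌉₊ * (⌈s⌉₊ + 1) / (2 * ((q : ℝ) + 2)) := by
    rw [lt_div_iff₀ (by linarith)]
    nlinarith
  linarith
end

section
/- Let S₀ be a set of points of a finite projective plane Π_q of order q ≥ 2 with |S₀| ≥ 2, and let x ≠ y be two points, each not in S₀ and not saturated by S₀. Let ℓ be the unique line through x and y. If ℓ contains no point of S₀, then |H(x) ∩ H(y)| = |S₀|·(|S₀|−1); if ℓ contains a point of S₀, then |H(x) ∩ H(y)| = (|S₀|−1)·(|S₀|−2) + q. -/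
/-- For a point x outside S₀ not saturated by S₀, the set of points outside S₀
lying on some line through x and a point of S₀. -/
def ProjPlane.Hset {Point Line : Type*} {q : ℕ} (PP : ProjPlane Point Line q)
    (S₀ : Set Point) (x : Point) : Set Point :=
  {p : Point | p ∉ S₀ ∧ ∃ l : Line, PP.Incid x l ∧
    (∃ s ∈ S₀, PP.Incid s l) ∧ PP.Incid p l}

namespace ProjPlane

variable {Point Line : Type*} {q : ℕ} (PP : ProjPlane Point Line q)

theorem line_eq_s13 {a b : Point} {m n : Line} (hab : a ≠ b) (ham : PP.Incid a m)
    (hbm : PP.Incid b m) (han : PP.Incid a n) (hbn : PP.Incid b n) : m = n :=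
  (PP.exists_unique_line hab).unique ⟨ham, hbm⟩ ⟨han, hbn⟩

theorem point_eq_s13 {a b : Point} {m n : Line} (hmn : m ≠ n) (ham : PP.Incid a m)
    (han : PP.Incid a n) (hbm : PP.Incid b m) (hbn : PP.Incid b n) : a = b :=
  (PP.exists_unique_point hmn).unique ⟨ham, han⟩ ⟨hbm, hbn⟩

variable {PP}

theorem eq_of_not_saturated {S : Set Point} {x a b : Point} {m : Line}
    (hx : ¬ PP.Saturated S x) (ha : a ∈ S) (hb : b ∈ S) (hxm : PP.Incid x m)
    (ham : PP.Incid a m) (hbm : PP.Incid b m) : a = b := by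
  by_contra h
  exact hx (Or.inr ⟨m, hxm, a, ha, b, hb, h, ham, hbm⟩)

/-- Off the line `l` through `x` and `y`, the points of `H(x) ∩ H(y)` correspond to the ordered
pairs of distinct points of `S` off `l`. -/
theorem ncard_Hset_inter_off_line {S : Set Point} (hS : S.Finite) {x y : Point} (hxy : x ≠ y)
    (hsx : ¬ PP.Saturated S x) (hsy : ¬ PP.Saturated S y)
    {l : Line} (hxl : PP.Incid x l) (hyl : PP.Incid y l) :
    {p ∈ PP.Hset S x ∩ PP.Hset S y | ¬ PP.Incid p l}.ncard =
      {s ∈ S | ¬ PP.Incid s l}.ncard * ({s ∈ S | ¬ PP.Incid s l}.ncard - 1) := by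
  classical
  set T : Set Point := {s ∈ S | ¬ PP.Incid s l}
  have hTfin : T.Finite := hS.subset (Set.sep_subset _ _)
  have key : ∀ z : Point × Point, ∃ p, z.1 ∈ T → z.2 ∈ T →
      ∃ m n, PP.Incid x m ∧ PP.Incid z.1 m ∧ PP.Incid p m ∧
        PP.Incid y n ∧ PP.Incid z.2 n ∧ PP.Incid p n ∧ ¬ PP.Incid p l := by
    rintro ⟨s, t⟩
    by_cases h : s ∈ T ∧ t ∈ T
    · obtain ⟨hs, ht⟩ := h
      obtain ⟨m, ⟨hxm, hsm⟩, -⟩ := PP.exists_unique_line (p := x) (p' := s)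
        fun h => hs.2 (h ▸ hxl)
      obtain ⟨n, ⟨hyn, htn⟩, -⟩ := PP.exists_unique_line (p := y) (p' := t)
        fun h => ht.2 (h ▸ hyl)
      have hml : m ≠ l := fun h => hs.2 (h ▸ hsm)
      have hnl : n ≠ l := fun h => ht.2 (h ▸ htn)
      have hmn : m ≠ n := fun h => hml (PP.line_eq_s13 hxy hxm (h ▸ hyn) hxl hyl)
      obtain ⟨p, ⟨hpm, hpn⟩, -⟩ := PP.exists_unique_point hmn
      refine ⟨p, fun _ _ => ⟨m, n, hxm, hsm, hpm, hyn, htn, hpn, fun hpl => hxy ?_⟩⟩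
      exact (PP.point_eq_s13 hml hxm hxl hpm hpl).trans (PP.point_eq_s13 hnl hpn hpl hyn hyl)
    · exact ⟨s, fun hs ht => (h ⟨hs, ht⟩).elim⟩
  choose f hf using key
  have hbij : Set.BijOn f T.offDiag {p ∈ PP.Hset S x ∩ PP.Hset S y | ¬ PP.Incid p l} := by
    refine ⟨?_, ?_, ?_⟩
    · rintro ⟨s, t⟩ ⟨hs, ht, hst⟩
      obtain ⟨m, n, hxm, hsm, hpm, hyn, htn, hpn, hpl⟩ := hf (s, t) hs ht
      have hpS : f (s, t) ∉ S := fun hp => hst <|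
        (eq_of_not_saturated hsx hs.1 hp hxm hsm hpm).trans
          (eq_of_not_saturated hsy hp ht.1 hyn hpn htn)
      exact ⟨⟨⟨hpS, m, hxm, ⟨s, hs.1, hsm⟩, hpm⟩, ⟨hpS, n, hyn, ⟨t, ht.1, htn⟩, hpn⟩⟩, hpl⟩
    · rintro ⟨s, t⟩ ⟨hs, ht, -⟩ ⟨s', t'⟩ ⟨hs', ht', -⟩ heq
      obtain ⟨m, n, hxm, hsm, hpm, hyn, htn, hpn, hpl⟩ := hf (s, t) hs ht
      obtain ⟨m', n', hxm', hsm', hpm', hyn', htn', hpn', -⟩ := hf (s', t') hs' ht'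
      rw [← heq] at hpm' hpn'
      have hm : m = m' := PP.line_eq_s13 (by exact fun h => hpl (h ▸ hxl)) hxm hpm hxm' hpm'
      have hn : n = n' := PP.line_eq_s13 (by exact fun h => hpl (h ▸ hyl)) hyn hpn hyn' hpn'
      subst hm hn
      exact Prod.ext (eq_of_not_saturated hsx hs.1 hs'.1 hxm hsm hsm')
        (eq_of_not_saturated hsy ht.1 ht'.1 hyn htn htn')
    · rintro p ⟨⟨⟨hpS, m, hxm, ⟨s, hs, hsm⟩, hpm⟩, ⟨-, n, hyn, ⟨t, ht, htn⟩, hpn⟩⟩, hpl⟩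
      have hml : m ≠ l := fun h => hpl (h ▸ hpm)
      have hnl : n ≠ l := fun h => hpl (h ▸ hpn)
      have hsl : ¬ PP.Incid s l := fun h =>
        hsx (Or.inl (PP.point_eq_s13 hml hxm hxl hsm h ▸ hs))
      have htl : ¬ PP.Incid t l := fun h =>
        hsy (Or.inl (PP.point_eq_s13 hnl hyn hyl htn h ▸ ht))
      have hmn : m ≠ n := fun h => hml (PP.line_eq_s13 hxy hxm (h ▸ hyn) hxl hyl)
      have hst : s ≠ t := fun h =>
        hpS (PP.point_eq_s13 hmn hpm hpn hsm (h ▸ htn) ▸ hs)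
      refine ⟨(s, t), ⟨⟨hs, hsl⟩, ⟨ht, htl⟩, hst⟩, ?_⟩
      obtain ⟨m', n', hxm', hsm', hpm', hyn', htn', hpn', -⟩ := hf (s, t) ⟨hs, hsl⟩ ⟨ht, htl⟩
      have hm : m = m' := PP.line_eq_s13 (by exact fun h => hsl (h ▸ hxl)) hxm hsm hxm' hsm'
      have hn : n = n' := PP.line_eq_s13 (by exact fun h => htl (h ▸ hyl)) hyn htn hyn' htn'
      subst hm hn
      exact PP.point_eq_s13 hmn hpm' hpn' hpm hpn
  rw [← hbij.image_eq, hbij.injOn.ncard_image]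
  clear_value T
  lift T to Finset Point using hTfin
  rw [← Finset.coe_offDiag, Set.ncard_coe_finset, Set.ncard_coe_finset, Finset.offDiag_card,
    Nat.mul_sub_one]

end ProjPlane

/-- If x ≠ y are points outside S₀, neither saturated by S₀, and ℓ is the line
through x and y, then |H(x) ∩ H(y)| = |S₀|(|S₀|−1) if ℓ is skew to S₀, and
|H(x) ∩ H(y)| = (|S₀|−1)(|S₀|−2) + q if ℓ meets S₀. -/
theorem H_intersection_card {Point Line : Type*} {q : ℕ} (hq : 2 ≤ q)
    (PP : ProjPlane Point Line q) (S₀ : Set Point) (hS : 2 ≤ S₀.ncard)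
    (x y : Point) (hxy : x ≠ y) (hx : x ∉ S₀) (hy : y ∉ S₀)
    (hsx : ¬ PP.Saturated S₀ x) (hsy : ¬ PP.Saturated S₀ y)
    (l : Line) (hxl : PP.Incid x l) (hyl : PP.Incid y l) :
    ((∀ s ∈ S₀, ¬ PP.Incid s l) →
        (PP.Hset S₀ x ∩ PP.Hset S₀ y).ncard = S₀.ncard * (S₀.ncard - 1)) ∧
    ((∃ s ∈ S₀, PP.Incid s l) →
        (PP.Hset S₀ x ∩ PP.Hset S₀ y).ncard
          = (S₀.ncard - 1) * (S₀.ncard - 2) + q) := by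
  have hS₀ : S₀.Finite := Set.finite_of_ncard_pos (by omega)
  have hoff := ProjPlane.ncard_Hset_inter_off_line hS₀ hxy hsx hsy hxl hyl
  refine ⟨fun hskew => ?_, ?_⟩
  · have hT : {s ∈ S₀ | ¬ PP.Incid s l} = S₀ := Set.sep_eq_self_iff_mem_true.2 hskew
    have hA : {p ∈ PP.Hset S₀ x ∩ PP.Hset S₀ y | ¬ PP.Incid p l} =
        PP.Hset S₀ x ∩ PP.Hset S₀ y := by
      refine Set.sep_eq_self_iff_mem_true.2 ?_
      rintro p ⟨⟨-, m, hxm, ⟨s, hs, hsm⟩, hpm⟩, ⟨-, n, hyn, ⟨t, ht, htn⟩, hpn⟩⟩ hpl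
      have hml : m ≠ l := fun h => hskew s hs (h ▸ hsm)
      have hnl : n ≠ l := fun h => hskew t ht (h ▸ htn)
      exact hxy ((PP.point_eq_s13 hml hxm hxl hpm hpl).trans (PP.point_eq_s13 hnl hpn hpl hyn hyl))
    rwa [hA, hT] at hoff
  · rintro ⟨s, hs, hsl⟩
    have : Finite Point := Nat.finite_of_card_ne_zero (by rw [PP.card_points]; omega)
    have huniq : ∀ t ∈ S₀, PP.Incid t l → t = s := fun t ht htl =>
      ProjPlane.eq_of_not_saturated hsx ht hs hxl htl hsl
    have hT : {t ∈ S₀ | ¬ PP.Incid t l} = S₀ \ {s} := by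
      ext t
      exact ⟨fun h => ⟨h.1, fun hts => h.2 (hts ▸ hsl)⟩,
        fun h => ⟨h.1, fun htl => h.2 (huniq t h.1 htl)⟩⟩
    have hon : {p ∈ PP.Hset S₀ x ∩ PP.Hset S₀ y | PP.Incid p l} = {p | PP.Incid p l} \ {s} := by
      ext p
      constructor
      · rintro ⟨⟨⟨hpS, -⟩, -⟩, hpl⟩
        exact ⟨hpl, fun hps => hpS (hps ▸ hs)⟩
      · rintro ⟨hpl, hps⟩
        have hpS : p ∉ S₀ := fun hp => hps (huniq p hp hpl)
        exact ⟨⟨⟨hpS, l, hxl, ⟨s, hs, hsl⟩, hpl⟩, ⟨hpS, l, hyl, ⟨s, hs, hsl⟩, hpl⟩⟩, hpl⟩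
    have hline : {p | PP.Incid p l}.ncard = q + 1 := PP.card_line_points l
    have hon_card : {p ∈ PP.Hset S₀ x ∩ PP.Hset S₀ y | PP.Incid p l}.ncard = q := by
      rw [hon, Set.ncard_sdiff_singleton_of_mem (by exact hsl), hline, Nat.add_sub_cancel]
    rw [hT, Set.ncard_sdiff_singleton_of_mem hs, Nat.sub_sub] at hoff
    have hsplit := Set.ncard_inter_add_ncard_sdiff_eq_ncard
      (PP.Hset S₀ x ∩ PP.Hset S₀ y) {p | PP.Incid p l}
    rw [← hsplit, ← hoff, add_comm]
    exact congrArg _ hon_card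
end

section
/- Let F = {H₁, …, H_m} be a family of m ≥ 1 subsets of a finite ground set X that is r-uniform (|H_i| = r for all i, with r ≥ 1) and t-intersecting (|H_i ∩ H_j| ≥ t for all i ≠ j, with 1 ≤ t ≤ r). Then there is a fractional transversal of total weight at most rm/(r + (m−1)t); that is, the fractional transversal number satisfies τ*(F) ≤ rm/(r + (m−1)t). -/
/-- Summing over the points of `s` the number of members of `H` that contain them counts the
intersections of `s` with the members of `H`. -/
theorem sum_degree_eq_sum_card_inter {X ι : Type*} [DecidableEq X] [Fintype ι]
    (H : ι → Finset X) (s : Finset X) :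
    ∑ x ∈ s, (Finset.univ.filter fun j => x ∈ H j).card = ∑ j, (s ∩ H j).card := by
  simp_rw [Finset.card_filter]
  rw [Finset.sum_comm]
  simp_rw [← Finset.card_filter, Finset.filter_mem_eq_inter]

/-- An r-uniform t-intersecting family of m sets has a fractional transversal
of total weight at most rm/(r + (m−1)t). -/
theorem fractional_transversal_bound {X : Type*} [Fintype X] [DecidableEq X] {m r t : ℕ}
    (hm : 1 ≤ m) (hr : 1 ≤ r) (ht : 1 ≤ t) (htr : t ≤ r)
    (H : Fin m → Finset X)
    (hunif : ∀ i, (H i).card = r)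
    (hint : ∀ i j, i ≠ j → t ≤ ((H i) ∩ (H j)).card) :
    ∃ w : X → ℝ, (∀ x, 0 ≤ w x) ∧ (∀ i, 1 ≤ ∑ x ∈ H i, w x) ∧
      ∑ x : X, w x ≤ ((r : ℝ) * m) / ((r : ℝ) + ((m : ℝ) - 1) * t) := by
  have hD : (r : ℝ) + ((m : ℝ) - 1) * t = ((r + (m - 1) * t : ℕ) : ℝ) := by
    push_cast [Nat.cast_sub hm]
    ring
  have hpos : (0 : ℝ) < ((r + (m - 1) * t : ℕ) : ℝ) := by
    exact_mod_cast Nat.add_pos_left hr _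
  rw [hD]
  refine ⟨fun x => ((Finset.univ.filter fun j => x ∈ H j).card : ℝ) / (r + (m - 1) * t : ℕ),
    fun x => by positivity, fun i => ?_, ?_⟩
  · rw [← Finset.sum_div, one_le_div hpos, ← Nat.cast_sum, Nat.cast_le,
      sum_degree_eq_sum_card_inter, ← Finset.add_sum_erase _ _ (Finset.mem_univ i),
      Finset.inter_self, hunif]
    have h := Finset.card_nsmul_le_sum (Finset.univ.erase i) (fun j => (H i ∩ H j).card) t
      fun j hj => hint i j (Finset.ne_of_mem_erase hj).symm
    simp only [Finset.card_erase_of_mem (Finset.mem_univ i), Finset.card_univ, Fintype.card_fin,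
      smul_eq_mul] at h
    exact Nat.add_le_add_left h r
  · rw [← Finset.sum_div, ← Nat.cast_sum, sum_degree_eq_sum_card_inter]
    simp [hunif, mul_comm]
end

section
/- Let F = {H₁, …, H_m} be a family of m ≥ 1 subsets of a finite ground set X that is r-uniform (|H_i| = r for all i, with r ≥ 1) and t-intersecting (|H_i ∩ H_j| ≥ t for all i ≠ j, with 1 ≤ t ≤ r), and let d ≥ 1 be the maximum degree, i.e., the maximum over x ∈ X of the number of indices i with x ∈ H_i. Then the transversal number satisfies τ(F) ≤ (1 + ln d)·rm/(r + (m−1)t) (as real numbers). -/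
/-- Increments of the harmonic numbers up to `k` are at least `1 / k`. -/
lemma sub_div_le_harmonic_sub {a b k : ℕ} (hba : b ≤ a) (hak : a ≤ k) :
    ((a : ℝ) - b) / k ≤ (harmonic a : ℝ) - harmonic b := by
  induction a, hba using Nat.le_induction with
  | base => simp
  | succ n hn ih =>
    have hrec := ih (by omega)
    have hle : (1 : ℝ) / k ≤ ((n + 1 : ℕ) : ℝ)⁻¹ := by
      rw [one_div]
      exact inv_anti₀ (by positivity) (by exact_mod_cast hak)
    rw [harmonic_succ]
    push_cast at hle ⊢
    calc ((n : ℝ) + 1 - b) / k = ((n : ℝ) - b) / k + 1 / k := by ring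
      _ ≤ _ := by linarith

open scoped Classical in
/-- Double counting of weighted incidences. -/
lemma sum_mul_card_filter_mem {X ι R : Type*} [Fintype X] [CommSemiring R] (w : X → R)
    (H : ι → Finset X) (S : Finset ι) :
    ∑ x, w x * ((S.filter fun i => x ∈ H i).card : R) = ∑ i ∈ S, ∑ x ∈ H i, w x := by
  simp_rw [Finset.card_filter, Nat.cast_sum, Finset.mul_sum]
  rw [Finset.sum_comm]
  refine Finset.sum_congr rfl fun i _ => ?_
  simp

open scoped Classical in
/-- The greedy transversal bound: a fractional transversal `w` gives a transversal of size at most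
`∑ x, w x * harmonic (deg x)`. -/
lemma exists_transversal_card_le_sum_harmonic {X ι : Type*} [Fintype X] (w : X → ℝ)
    (hw : ∀ x, 0 ≤ w x) (H : ι → Finset X) (S : Finset ι)
    (hcov : ∀ i ∈ S, 1 ≤ ∑ x ∈ H i, w x) :
    ∃ T : Finset X, (∀ i ∈ S, (H i ∩ T).Nonempty) ∧
      (T.card : ℝ) ≤ ∑ x, w x * (harmonic (S.filter fun i => x ∈ H i).card : ℝ) := by
  induction S using Finset.strongInduction with
  | H S ih =>
    rcases S.eq_empty_or_nonempty with rfl | ⟨i₀, hi₀⟩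
    · exact ⟨∅, by simp, by simp⟩
    have hne : (H i₀).Nonempty := by
      by_contra h
      have := hcov i₀ hi₀
      rw [Finset.not_nonempty_iff_eq_empty.mp h] at this
      norm_num at this
    obtain ⟨x₀, hx₀⟩ := hne
    obtain ⟨y, -, hy⟩ := Finset.exists_max_image Finset.univ
      (fun x => (S.filter fun i => x ∈ H i).card) ⟨x₀, Finset.mem_univ _⟩
    set k := (S.filter fun i => y ∈ H i).card with hk
    have hkpos : 0 < k := lt_of_lt_of_le
      (Finset.card_pos.mpr ⟨i₀, Finset.mem_filter.mpr ⟨hi₀, hx₀⟩⟩) (hy x₀ (Finset.mem_univ _))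
    set S' := S.filter fun i => y ∉ H i with hS'
    have hsub : S' ⊆ S := Finset.filter_subset _ _
    have hss : S' ⊂ S := by
      obtain ⟨j, hj⟩ := Finset.card_pos.mp hkpos
      rw [Finset.mem_filter] at hj
      exact Finset.filter_ssubset.mpr ⟨j, hj.1, not_not.mpr hj.2⟩
    obtain ⟨T, hT, hcard⟩ := ih S' hss fun i hi => hcov i (hsub hi)
    refine ⟨insert y T, fun i hi => ?_, ?_⟩
    · by_cases hyi : y ∈ H i
      · exact ⟨y, by simp [hyi]⟩
      · exact (hT i (Finset.mem_filter.mpr ⟨hi, hyi⟩)).mono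
          (Finset.inter_subset_inter_left (Finset.subset_insert _ _))
    have hgain : (1 : ℝ) ≤ ∑ x, w x * ((harmonic (S.filter fun i => x ∈ H i).card : ℝ)
        - harmonic (S'.filter fun i => x ∈ H i).card) := by
      have hcount : (k : ℝ) ≤ ∑ x, w x * (((S.filter fun i => x ∈ H i).card : ℝ)
          - (S'.filter fun i => x ∈ H i).card) := by
        simp_rw [mul_sub]
        rw [Finset.sum_sub_distrib, sum_mul_card_filter_mem, sum_mul_card_filter_mem,
          ← Finset.sum_filter_add_sum_filter_not S (fun i => y ∈ H i), add_sub_cancel_right]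
        calc (k : ℝ) = ∑ i ∈ S.filter fun i => y ∈ H i, (1 : ℝ) := by simp [hk]
          _ ≤ _ := Finset.sum_le_sum fun i hi => hcov i (Finset.mem_filter.mp hi).1
      calc (1 : ℝ) ≤ (∑ x, w x * (((S.filter fun i => x ∈ H i).card : ℝ)
            - (S'.filter fun i => x ∈ H i).card)) / k :=
            (one_le_div (by exact_mod_cast hkpos)).mpr hcount
        _ = ∑ x, w x * ((((S.filter fun i => x ∈ H i).card : ℝ)
            - (S'.filter fun i => x ∈ H i).card) / k) := by
            rw [Finset.sum_div]
            exact Finset.sum_congr rfl fun x _ => mul_div_assoc _ _ _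
        _ ≤ _ := Finset.sum_le_sum fun x _ => mul_le_mul_of_nonneg_left
            (sub_div_le_harmonic_sub
              (Finset.card_le_card (Finset.filter_subset_filter _ hsub))
              (hy x (Finset.mem_univ _))) (hw x)
    simp_rw [mul_sub] at hgain
    rw [Finset.sum_sub_distrib] at hgain
    have hins : ((insert y T).card : ℝ) ≤ T.card + 1 := by
      exact_mod_cast Finset.card_insert_le y T
    linarith

open scoped Classical in
/-- Lovász-type bound: an r-uniform t-intersecting family of m sets with
maximum degree d has a transversal of size at most
(1 + ln d)·rm/(r + (m−1)t). -/
theorem transversal_bound_via_degree {X : Type*} [Fintype X] {m r t d : ℕ}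
    (hm : 1 ≤ m) (hr : 1 ≤ r) (ht : 1 ≤ t) (htr : t ≤ r) (hd1 : 1 ≤ d)
    (H : Fin m → Finset X)
    (hunif : ∀ i, (H i).card = r)
    (hint : ∀ i j, i ≠ j → t ≤ ((H i) ∩ (H j)).card)
    (hd : d = Finset.univ.sup fun x : X =>
      (Finset.univ.filter fun i : Fin m => x ∈ H i).card) :
    ∃ T : Finset X, (∀ i, ((H i) ∩ T).Nonempty) ∧
      (T.card : ℝ) ≤ (1 + Real.log d) *
        (((r : ℝ) * m) / ((r : ℝ) + ((m : ℝ) - 1) * t)) := by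
  have hm' : (1 : ℝ) ≤ m := by exact_mod_cast hm
  have hr' : (1 : ℝ) ≤ r := by exact_mod_cast hr
  set D : ℝ := (r : ℝ) + ((m : ℝ) - 1) * t with hD
  have hDpos : 0 < D := by
    have : 0 ≤ ((m : ℝ) - 1) * t := mul_nonneg (by linarith) (by positivity)
    linarith
  let deg : X → ℕ := fun x => (Finset.univ.filter fun i : Fin m => x ∈ H i).card
  have hdeg : ∀ x, deg x ≤ d := fun x => hd ▸ Finset.le_sup (f := deg) (Finset.mem_univ x)
  have hcov : ∀ i ∈ (Finset.univ : Finset (Fin m)), 1 ≤ ∑ x ∈ H i, (deg x : ℝ) / D := by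
    intro i _
    rw [← Finset.sum_div, one_le_div hDpos]
    have hswap : ∑ x ∈ H i, (deg x : ℝ) = ∑ j, ((H i ∩ H j).card : ℝ) := by
      simp_rw [deg, Finset.card_filter, Nat.cast_sum]
      rw [Finset.sum_comm]
      refine Finset.sum_congr rfl fun j _ => ?_
      rw [← Finset.filter_mem_eq_inter, Finset.card_filter, Nat.cast_sum]
    rw [hswap, ← Finset.add_sum_erase _ _ (Finset.mem_univ i), Finset.inter_self, hunif]
    have hrest : ((m : ℝ) - 1) * t ≤
        ∑ j ∈ Finset.univ.erase i, ((H i ∩ H j).card : ℝ) := by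
      have := Finset.card_nsmul_le_sum (Finset.univ.erase i)
        (fun j => ((H i ∩ H j).card : ℝ)) t fun j hj => by
          exact_mod_cast hint i j (Finset.ne_of_mem_erase hj).symm
      rw [Finset.card_erase_of_mem (Finset.mem_univ i), Finset.card_univ, Fintype.card_fin,
        nsmul_eq_mul, Nat.cast_sub hm, Nat.cast_one] at this
      exact this
    linarith
  obtain ⟨T, hT, hcard⟩ := exists_transversal_card_le_sum_harmonic (fun x => (deg x : ℝ) / D)
    (fun x => by positivity) H Finset.univ hcov
  refine ⟨T, fun i => hT i (Finset.mem_univ i), hcard.trans ?_⟩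
  have htotal : ∑ x, (deg x : ℝ) / D = (r : ℝ) * m / D := by
    rw [← Finset.sum_div]
    have := sum_mul_card_filter_mem (fun _ => (1 : ℝ)) H Finset.univ
    simp only [one_mul, Finset.sum_const, hunif, nsmul_eq_mul, mul_one, Finset.card_univ,
      Fintype.card_fin] at this
    rw [this, mul_comm]
  rw [← htotal, Finset.mul_sum]
  refine Finset.sum_le_sum fun x _ => ?_
  rw [mul_comm]
  refine mul_le_mul_of_nonneg_right ?_ (by positivity)
  have hmono := sub_div_le_harmonic_sub (hdeg x) le_rfl
  have hnonneg : (0 : ℝ) ≤ ((d : ℝ) - deg x) / d :=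
    div_nonneg (sub_nonneg.mpr (by exact_mod_cast hdeg x)) (by positivity)
  exact (by linarith : (harmonic (deg x) : ℝ) ≤ harmonic d).trans (harmonic_le_one_add_log d)
end

section
/- Let F = {H₁, …, H_m} be a family of m ≥ 2 distinct subsets of a finite ground set X that is r-uniform (|H_i| = r for all i, with r ≥ 1) and t-intersecting (|H_i ∩ H_j| ≥ t for all i ≠ j, with 1 ≤ t ≤ r). Then the transversal number satisfies τ(F) ≤ ⌈(rm/(tm + r))·ln m⌉. -/
open Finset in
/-- If a probability weight `w` gives every member of a family mass at least `p`, then some set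
of at most `k` points misses at most a `(1 - p) ^ k` fraction of the family. -/
theorem exists_card_le_card_disjoint_le {ι X : Type*} [Fintype ι] [Fintype X] [DecidableEq X]
    (H : ι → Finset X) (w : X → ℝ) (hw : ∀ x, 0 ≤ w x) (hw1 : ∑ x, w x = 1) {p : ℝ} (hp1 : p ≤ 1)
    (hp : ∀ i, p ≤ ∑ x ∈ H i, w x) (k : ℕ) :
    ∃ T : Finset X, #T ≤ k ∧
      (#{i | Disjoint (H i) T} : ℝ) ≤ Fintype.card ι * (1 - p) ^ k := by
  induction k with
  | zero => exact ⟨∅, by simp⟩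
  | succ k ih =>
    obtain ⟨T, hTk, hT⟩ := ih
    set S : Finset ι := {i | Disjoint (H i) T} with hS
    have havg : p * #S ≤ ∑ x, w x * #{i ∈ S | x ∈ H i} := by
      calc p * #S = ∑ i ∈ S, p := by simp [mul_comm]
        _ ≤ ∑ i ∈ S, ∑ x ∈ H i, w x := sum_le_sum fun i _ => hp i
        _ = ∑ i ∈ S, ∑ x, if x ∈ H i then w x else 0 := by simp
        _ = ∑ x, w x * #{i ∈ S | x ∈ H i} := by
          rw [sum_comm]
          refine sum_congr rfl fun x _ => ?_
          rw [← sum_filter, sum_const, nsmul_eq_mul, mul_comm]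
    obtain ⟨x, hx⟩ : ∃ x, p * #S ≤ #{i ∈ S | x ∈ H i} := by
      by_contra! hlt
      obtain ⟨y, -, hy⟩ : ∃ y ∈ univ, 0 < w y :=
        exists_lt_of_sum_lt (f := fun _ : X => (0 : ℝ)) (by simp [hw1])
      have : ∑ x, w x * #{i ∈ S | x ∈ H i} < ∑ x, w x * (p * #S) :=
        sum_lt_sum (fun x _ => mul_le_mul_of_nonneg_left (hlt x).le (hw x))
          ⟨y, mem_univ y, mul_lt_mul_of_pos_left (hlt y) hy⟩
      rw [← sum_mul, hw1, one_mul] at this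
      exact this.not_ge havg
    refine ⟨insert x T, (card_insert_le x T).trans (by lia), ?_⟩
    have hrest : ({i | Disjoint (H i) (insert x T)} : Finset ι) = {i ∈ S | x ∉ H i} := by
      ext i
      simp [hS, and_comm]
    have hsplit : (#{i ∈ S | x ∈ H i} : ℝ) + #{i ∈ S | x ∉ H i} = #S := by
      exact_mod_cast card_filter_add_card_filter_not (s := S) (fun i => x ∈ H i)
    rw [hrest]
    calc (#{i ∈ S | x ∉ H i} : ℝ) ≤ (1 - p) * #S := by linarith
      _ ≤ (1 - p) * (Fintype.card ι * (1 - p) ^ k) :=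
        mul_le_mul_of_nonneg_left hT (by linarith)
      _ = Fintype.card ι * (1 - p) ^ (k + 1) := by ring

open Finset in
/-- Each member of an `r`-uniform `t`-intersecting family has degree sum at least
`r + t * (m - 1)`. -/
theorem le_sum_degree {ι X : Type*} [Fintype ι] [DecidableEq ι] [Fintype X] [DecidableEq X]
    {r t : ℕ} (H : ι → Finset X) (hunif : ∀ i, #(H i) = r)
    (hint : ∀ i j, i ≠ j → t ≤ #(H i ∩ H j)) (i : ι) :
    r + t * (Fintype.card ι - 1) ≤ ∑ x ∈ H i, #{j | x ∈ H j} := by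
  have hcount : ∑ x ∈ H i, #{j | x ∈ H j} = ∑ j, #(H i ∩ H j) := by
    simp_rw [card_filter]
    rw [sum_comm]
    simp
  rw [hcount, ← add_sum_erase univ _ (mem_univ i), inter_self, hunif]
  have := card_nsmul_le_sum (univ.erase i) (fun j => #(H i ∩ H j)) t
    fun j hj => hint i j (ne_of_mem_erase hj).symm
  rw [card_erase_of_mem (mem_univ i), card_univ, smul_eq_mul] at this
  lia

/-- Greedy bound: an r-uniform t-intersecting family of m ≥ 2 distinct sets
has a transversal of size at most ⌈(rm/(tm+r))·ln m⌉. -/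
theorem transversal_bound_greedy {X : Type*} [Fintype X] [DecidableEq X] {m r t : ℕ}
    (hm : 2 ≤ m) (hr : 1 ≤ r) (ht : 1 ≤ t) (htr : t ≤ r)
    (H : Fin m → Finset X) (hinj : Function.Injective H)
    (hunif : ∀ i, (H i).card = r)
    (hint : ∀ i j, i ≠ j → t ≤ ((H i) ∩ (H j)).card) :
    ∃ T : Finset X, (∀ i, ((H i) ∩ T).Nonempty) ∧
      T.card ≤ ⌈(((r : ℝ) * m) / ((t : ℝ) * m + r)) * Real.log m⌉₊ := by
  have hm0 : (0 : ℝ) < m := by positivity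
  have hr0 : (0 : ℝ) < r := by positivity
  have ht0 : (0 : ℝ) < t := by positivity
  have ha : (t : ℝ) / r ≤ 1 := (div_le_one hr0).2 (by exact_mod_cast htr)
  have hm1 : (1 : ℝ) < m := by exact_mod_cast hm
  have hb : (1 : ℝ) / m < 1 := (div_lt_one hm0).2 hm1
  have hlog : 0 < Real.log m := Real.log_pos hm1
  set k := ⌈(((r : ℝ) * m) / ((t : ℝ) * m + r)) * Real.log m⌉₊ with hk
  have hk0 : k ≠ 0 := (Nat.ceil_pos.2 (by positivity)).ne'
  have hkle : Real.log m ≤ k * ((t : ℝ) / r + 1 / m) := by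
    have hle := Nat.le_ceil ((((r : ℝ) * m) / ((t : ℝ) * m + r)) * Real.log m)
    rw [← hk, div_mul_eq_mul_div, div_le_iff₀ (by positivity)] at hle
    rw [div_add_div _ _ hr0.ne' hm0.ne', ← mul_div_assoc, le_div_iff₀ (by positivity)]
    linarith
  have hdeg : ∑ x, ((Finset.univ.filter fun j => x ∈ H j).card : ℝ) = r * m := by
    have := Finset.sum_card_bipartiteAbove_eq_sum_card_bipartiteBelow
      (s := Finset.univ) (t := Finset.univ) (fun (x : X) (j : Fin m) => x ∈ H j)
    simp only [Finset.bipartiteAbove, Finset.bipartiteBelow, Finset.filter_univ_mem, hunif,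
      Finset.sum_const, Finset.card_univ, Fintype.card_fin, smul_eq_mul] at this
    rw [mul_comm]
    exact_mod_cast this
  obtain ⟨T, hTk, hT⟩ := exists_card_le_card_disjoint_le H
    (fun x => ((Finset.univ.filter fun j => x ∈ H j).card : ℝ) / (r * m))
    (fun x => by positivity)
    (by rw [← Finset.sum_div, hdeg, div_self (by positivity)])
    (p := 1 - (1 - (t : ℝ) / r) * (1 - 1 / m))
    (by nlinarith)
    (fun i => by
      have h := le_sum_degree H hunif hint i
      rw [Fintype.card_fin] at h
      have h' : (r : ℝ) + t * (m - 1) ≤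
          ∑ x ∈ H i, ((Finset.univ.filter fun j => x ∈ H j).card : ℝ) := by
        rw [← Nat.cast_one, ← Nat.cast_sub (by lia)]
        exact_mod_cast h
      rw [← Finset.sum_div, le_div_iff₀ (by positivity)]
      refine le_trans (le_of_eq ?_) h'
      field_simp
      ring) k
  refine ⟨T, fun i => ?_, hTk⟩
  rw [sub_sub_cancel, Fintype.card_fin] at hT
  have hfactor : (1 - (t : ℝ) / r) * (1 - 1 / m) < Real.exp (-((t : ℝ) / r + 1 / m)) := by
    rw [neg_add, Real.exp_add]
    have h1 := Real.one_sub_le_exp_neg ((t : ℝ) / r)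
    have h2 : 1 - 1 / (m : ℝ) < Real.exp (-(1 / m)) := by
      have := Real.add_one_lt_exp (x := -(1 / (m : ℝ))) (by simp; lia)
      linarith
    exact mul_lt_mul' h1 h2 (by linarith) (Real.exp_pos _)
  have hlt : (m : ℝ) * ((1 - (t : ℝ) / r) * (1 - 1 / m)) ^ k < 1 := by
    calc (m : ℝ) * ((1 - (t : ℝ) / r) * (1 - 1 / m)) ^ k
        < m * Real.exp (-((t : ℝ) / r + 1 / m)) ^ k := by
          have : 0 ≤ (1 - (t : ℝ) / r) * (1 - 1 / m) :=
            mul_nonneg (by linarith) (by linarith)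
          gcongr
      _ = Real.exp (Real.log m - k * ((t : ℝ) / r + 1 / m)) := by
          rw [← Real.exp_nat_mul, sub_eq_add_neg, Real.exp_add, Real.exp_log hm0, mul_neg]
      _ ≤ 1 := Real.exp_le_one_iff.2 (by linarith)
  have hzero := hT.trans_lt hlt
  rw [Nat.cast_lt_one, Finset.card_eq_zero, Finset.filter_eq_empty_iff] at hzero
  exact Finset.not_disjoint_iff_nonempty_inter.1 (hzero (Finset.mem_univ i))
end

section
/- Let F_q be a finite field with q elements and let n ≥ 2. If S is a saturating set of the projective space PG(n,q), then |S| ≥ √2 · q^{(n−1)/2} (as real numbers). -/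
/-- The vectors lying over a secant of `T` meet at most `(#F - 1) ^ 2` nontrivial combinations per
unordered pair of points. If these, together with the multiples of points of `T`, exhaust the
nonzero vectors, the number of nonzero vectors is bounded accordingly. -/
theorem card_vectors_le_of_secants_cover {F V : Type*} [Field F] [Fintype F] [AddCommGroup V]
    [Module F V] [Fintype V] (T : Finset (Projectivization F V))
    (hT : ∀ v : V, v ≠ 0 → (∃ a ∈ T, ∃ c : Fˣ, v = c • a.rep) ∨
      ∃ a ∈ T, ∃ b ∈ T, a ≠ b ∧ ∃ c d : Fˣ, v = c • a.rep + d • b.rep) :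
    Fintype.card V ≤ 1 + T.card * (Fintype.card F - 1)
      + T.card.choose 2 * (Fintype.card F - 1) ^ 2 := by
  classical
  let f : Finset (Projectivization F V) → Finset V := fun p ↦
    {v | ∃ a b, p = {a, b} ∧ ∃ c d : Fˣ, v = c • a.rep + d • b.rep}
  have hf : ∀ p ∈ T.powersetCard 2, (f p).card ≤ (Fintype.card F - 1) ^ 2 := by
    intro p hp
    obtain ⟨a, b, -, rfl⟩ := Finset.card_eq_two.1 (Finset.mem_powersetCard.1 hp).2
    have hsub : f {a, b} ⊆ (Finset.univ : Finset (Fˣ × Fˣ)).image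
        fun x ↦ x.1 • a.rep + x.2 • b.rep := by
      intro v hv
      obtain ⟨x, y, hab, c, d, rfl⟩ := (Finset.mem_filter.1 hv).2
      rw [← Finset.coe_inj] at hab
      push_cast at hab
      rcases Set.pair_eq_pair_iff.1 hab with ⟨rfl, rfl⟩ | ⟨rfl, rfl⟩
      · exact Finset.mem_image.2 ⟨(c, d), Finset.mem_univ _, rfl⟩
      · exact Finset.mem_image.2 ⟨(d, c), Finset.mem_univ _, add_comm _ _⟩
    refine (Finset.card_le_card hsub).trans (Finset.card_image_le.trans ?_)
    rw [Finset.card_univ, Fintype.card_prod, Fintype.card_units, sq]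
  let g : Projectivization F V → Finset V := fun a ↦
    (Finset.univ : Finset Fˣ).image fun c ↦ c • a.rep
  have hg : ∀ a ∈ T, (g a).card ≤ Fintype.card F - 1 := fun a _ ↦
    Finset.card_image_le.trans (by rw [Finset.card_univ, Fintype.card_units])
  have hcover : (Finset.univ : Finset V) ⊆ ({0} ∪ T.biUnion g) ∪ (T.powersetCard 2).biUnion f := by
    intro v _
    by_cases hv : v = 0
    · simp [hv]
    rcases hT v hv with ⟨a, ha, c, rfl⟩ | ⟨a, ha, b, hb, hab, c, d, rfl⟩
    · refine Finset.mem_union_left _ (Finset.mem_union_right _ (Finset.mem_biUnion.2 ⟨a, ha, ?_⟩))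
      exact Finset.mem_image.2 ⟨c, Finset.mem_univ _, rfl⟩
    · refine Finset.mem_union_right _ (Finset.mem_biUnion.2 ⟨{a, b}, ?_, ?_⟩)
      · refine Finset.mem_powersetCard.2 ⟨?_, Finset.card_pair hab⟩
        simp [Finset.insert_subset_iff, ha, hb]
      · exact Finset.mem_filter.2 ⟨Finset.mem_univ _, a, b, rfl, c, d, rfl⟩
  have h₁ := Finset.card_biUnion_le_card_mul _ _ _ hf
  have h₂ := Finset.card_biUnion_le_card_mul _ _ _ hg
  rw [Finset.card_powersetCard] at h₁
  calc Fintype.card V = (Finset.univ : Finset V).card := rfl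
    _ ≤ _ := Finset.card_le_card hcover
    _ ≤ _ := Finset.card_union_le _ _
    _ ≤ _ := add_le_add ((Finset.card_union_le _ _).trans
      (add_le_add (Finset.card_singleton _).le h₂)) h₁

/-- In a space of dimension `m + 2` over `F_q`, the counting bound forces `2 * q ^ m ≤ s ^ 2`. -/
theorem two_mul_pow_le_sq_of_counting {m q s : ℕ} (hq : 2 ≤ q)
    (h : q ^ (m + 2) ≤ 1 + s * (q - 1) + s.choose 2 * (q - 1) ^ 2) :
    2 * q ^ m ≤ s ^ 2 := by
  by_contra! hlt
  have hchoose : 2 * ((s.choose 2 : ℕ) : ℤ) = s ^ 2 - s := by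
    have := Nat.cast_choose_two ℚ s
    have hrat : (2 * (s.choose 2 : ℕ) : ℚ) = s ^ 2 - s := by rw [this]; ring
    exact_mod_cast hrat
  obtain ⟨r, rfl⟩ := Nat.exists_eq_add_of_le' hq
  have hpos : 1 ≤ (r + 2) ^ m := Nat.one_le_pow _ _ (by omega)
  have hs : s ≤ s ^ 2 := Nat.le_self_pow two_ne_zero s
  rw [pow_add, show r + 2 - 1 = r + 1 by omega] at h
  generalize (r + 2) ^ m = X at *
  zify at *
  have h2 : 2 * ((X : ℤ) * (r + 2) ^ 2) ≤ 2 + 2 * (s * (r + 1)) + (s ^ 2 - s) * (r + 1) ^ 2 := by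
    rw [← hchoose]; linarith
  have hr : (0 : ℤ) ≤ r := Int.natCast_nonneg r
  have hs0 : (0 : ℤ) ≤ s := Int.natCast_nonneg s
  have e1 : (s : ℤ) ^ 2 * (r + 1) ^ 2 ≤ (2 * X - 1) * (r + 1) ^ 2 :=
    mul_le_mul_of_nonneg_right (by linarith) (by positivity)
  have e2 : (s : ℤ) * (r + 1) * (1 - r) ≤ s := by
    nlinarith [mul_nonneg hs0 (mul_nonneg hr hr)]
  nlinarith [mul_nonneg hr (by linarith : (0 : ℤ) ≤ X)]

/-- Lunelli–Sce type lower bound in PG(n,q): a saturating set S of PG(n,q)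
satisfies |S| ≥ √2 · q^{(n−1)/2}. -/
theorem PG_saturating_lower_bound {F : Type*} [Field F] [Fintype F] {n q : ℕ}
    (hn : 2 ≤ n) (hq : Fintype.card F = q)
    (S : Set (Projectivization F (Fin (n + 1) → F)))
    (hS : ∀ P : Projectivization F (Fin (n + 1) → F), P ∉ S →
      ∃ a ∈ S, ∃ b ∈ S, a ≠ b ∧
        P.rep ∈ Submodule.span F {Projectivization.rep a, Projectivization.rep b}) :
    Real.sqrt 2 * (q : ℝ) ^ (((n : ℝ) - 1) / 2) ≤ (S.ncard : ℝ) := by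
  classical
  have hfin : S.Finite := Set.toFinite S
  have eq_of_rep {P a : Projectivization F (Fin (n + 1) → F)} {c : F} (h : P.rep = c • a.rep) :
      P = a := by
    rw [← P.mk_rep, ← a.mk_rep, Projectivization.mk_eq_mk_iff']
    exact ⟨c, h.symm⟩
  have key := card_vectors_le_of_secants_cover hfin.toFinset fun v hv ↦ by
    set P := Projectivization.mk F v hv with hP
    obtain ⟨u, hu⟩ : ∃ u : Fˣ, u • P.rep = v :=
      (Projectivization.mk_eq_mk_iff F _ _ hv P.rep_nonzero).1 (by rw [P.mk_rep])
    by_cases hPS : P ∈ S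
    · exact .inl ⟨P, hfin.mem_toFinset.2 hPS, u, hu.symm⟩
    obtain ⟨a, ha, b, hb, hab, hspan⟩ := hS P hPS
    obtain ⟨c, d, hcd⟩ := Submodule.mem_span_pair.1 hspan
    have hc : c ≠ 0 := by
      rintro rfl
      exact hPS (eq_of_rep (c := d) (by simpa using hcd.symm) ▸ hb)
    have hd : d ≠ 0 := by
      rintro rfl
      exact hPS (eq_of_rep (c := c) (by simpa using hcd.symm) ▸ ha)
    refine .inr ⟨a, hfin.mem_toFinset.2 ha, b, hfin.mem_toFinset.2 hb, hab,
      u * Units.mk0 c hc, u * Units.mk0 d hd, ?_⟩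
    rw [← hu, ← hcd, smul_add, mul_smul, mul_smul]
    rfl
  obtain ⟨m, rfl⟩ : ∃ m, n = m + 1 := ⟨n - 1, by omega⟩
  rw [Fintype.card_fun, Fintype.card_fin, hq, ← Set.ncard_eq_toFinset_card S hfin] at key
  have hbound := two_mul_pow_le_sq_of_counting (hq ▸ Fintype.one_lt_card) key
  refine le_of_sq_le_sq ?_ (Nat.cast_nonneg _)
  rw [mul_pow, Real.sq_sqrt zero_le_two, ← Real.rpow_mul_natCast (Nat.cast_nonneg q)]
  have hexp : (((m + 1 : ℕ) : ℝ) - 1) / 2 * (2 : ℕ) = m := by push_cast; ring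
  rw [hexp, Real.rpow_natCast]
  exact_mod_cast hbound
end

section
/- For every integer n ≥ 2 and every ε > 0 there exists q₀ such that for every finite field F_q with q = |F_q| ≥ q₀ elements, the projective space PG(n,q) contains a saturating set S with |S| ≤ (1 + ε)·√((n+1)·q^{n−1}·ln q). -/
open scoped LinearAlgebra.Projectivization

open Classical in
/-- The points that lie on no line spanned by (and are not equal to) points of `S`. -/
noncomputable def uncoveredPoints {K V : Type*} [Field K] [AddCommGroup V] [Module K V]
    [Fintype (ℙ K V)] (S : Finset (ℙ K V)) : Finset (ℙ K V) :=
  {P | ∀ a ∈ S, ∀ b ∈ S, P.rep ∉ Submodule.span K {a.rep, b.rep}}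

section

variable {K V : Type*} [Field K] [AddCommGroup V] [Module K V]

theorem Projectivization.eq_of_rep_eq_smul {P a : ℙ K V} {c : K} (h : P.rep = c • a.rep) :
    P = a := by
  rw [← P.mk_rep, ← a.mk_rep, Projectivization.mk_eq_mk_iff']
  exact ⟨c, h.symm⟩

theorem Projectivization.eq_of_rep_mem_span_pair_self {P a : ℙ K V}
    (h : P.rep ∈ Submodule.span K {a.rep, a.rep}) : P = a := by
  rw [Set.pair_eq_singleton, Submodule.mem_span_singleton] at h
  obtain ⟨c, hc⟩ := h
  exact eq_of_rep_eq_smul hc.symm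

variable [Fintype (ℙ K V)]

theorem mem_uncoveredPoints {S : Finset (ℙ K V)} {P : ℙ K V} :
    P ∈ uncoveredPoints S ↔ ∀ a ∈ S, ∀ b ∈ S, P.rep ∉ Submodule.span K {a.rep, b.rep} := by
  classical
  simp [uncoveredPoints]

open Classical in
/-- Adding any of the `|S| (q - 1)` further points on the lines joining an uncovered point `P`
to `S` covers `P`. -/
theorem card_mul_card_units_le_card_covering [Fintype K] {S : Finset (ℙ K V)} {P : ℙ K V}
    (hP : P ∈ uncoveredPoints S) :
    S.card * Fintype.card Kˣ ≤
      (Finset.univ.filter fun x => P ∉ uncoveredPoints (insert x S)).card := by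
  rw [mem_uncoveredPoints] at hP
  have hne (a : S) (t : Kˣ) : P.rep + (t : K) • a.1.rep ≠ 0 := by
    intro h
    refine hP a a.2 a a.2 ?_
    rw [eq_neg_of_add_eq_zero_left h]
    exact Submodule.neg_mem _ (Submodule.smul_mem _ _ (Submodule.subset_span (by simp)))
  let φ : S × Kˣ → ℙ K V := fun y => Projectivization.mk K _ (hne y.1 y.2)
  have hφ : Function.Injective φ := by
    rintro ⟨a, t⟩ ⟨b, s⟩ h
    obtain ⟨c, hc⟩ := (Projectivization.mk_eq_mk_iff' K _ _ _ _).1 h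
    simp only at hc
    by_cases hc1 : c = 1
    · subst hc1
      rw [one_smul, add_right_inj] at hc
      have hab : a = b := by
        apply Subtype.ext
        refine Projectivization.eq_of_rep_eq_smul (c := (t : K)⁻¹ * s) ?_
        rw [mul_smul, hc, smul_smul, inv_mul_cancel₀ t.ne_zero, one_smul]
      subst hab
      have hst : (s : K) = t := smul_left_injective K a.1.rep_nonzero hc
      rw [Units.ext hst]
    · refine absurd ?_ (hP a a.2 b b.2)
      have hc2 : c - 1 ≠ 0 := sub_ne_zero.2 hc1
      rw [Submodule.mem_span_pair]
      refine ⟨(c - 1)⁻¹ * t, -((c - 1)⁻¹ * (c * s)), ?_⟩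
      have h2 : (c - 1) • P.rep = (t : K) • a.1.rep - (c * s : K) • b.1.rep := by
        rw [smul_add, smul_smul] at hc
        rw [sub_smul, one_smul, sub_eq_sub_iff_add_eq_add, hc, add_comm]
      rw [mul_smul, neg_smul, mul_smul, ← sub_eq_add_neg, ← smul_sub, ← h2, smul_smul,
        inv_mul_cancel₀ hc2, one_smul]
  calc S.card * Fintype.card Kˣ = (Finset.univ.image φ).card := by
        rw [Finset.card_image_of_injective _ hφ, Finset.card_univ, Fintype.card_prod,
          Fintype.card_coe]
    _ ≤ _ := by
        refine Finset.card_le_card ?_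
        intro x hx
        obtain ⟨⟨a, t⟩, -, rfl⟩ := Finset.mem_image.1 hx
        simp only [Finset.mem_filter, Finset.mem_univ, true_and]
        intro h
        rw [mem_uncoveredPoints] at h
        refine h _ (Finset.mem_insert_self _ _) a (Finset.mem_insert_of_mem a.2) ?_
        obtain ⟨u, hu⟩ := Projectivization.exists_smul_eq_mk_rep K _ (hne a t)
        rw [Submodule.mem_span_pair]
        refine ⟨(u⁻¹ : Kˣ), -t, ?_⟩
        change ((u⁻¹ : Kˣ) : K) • (Projectivization.mk K _ (hne a t)).rep + _ = _
        rw [← hu, ← Units.smul_def, inv_smul_smul, neg_smul, add_neg_cancel_right]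

open Classical in
theorem uncoveredPoints_insert_subset (S : Finset (ℙ K V)) (x : ℙ K V) :
    uncoveredPoints (insert x S) ⊆ uncoveredPoints S := by
  intro P
  simp only [mem_uncoveredPoints]
  intro h a ha b hb
  exact h a (Finset.mem_insert_of_mem ha) b (Finset.mem_insert_of_mem hb)

open Classical in
theorem exists_mul_card_uncoveredPoints_insert_le [Fintype K] {S : Finset (ℙ K V)}
    (hS : (uncoveredPoints S).Nonempty) :
    ∃ x ∉ S, ((uncoveredPoints (insert x S)).card : ℝ) ≤ (uncoveredPoints S).card *
      (1 - S.card * ((Fintype.card K - 1) / Fintype.card (ℙ K V))) := by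
  have hq : ((Fintype.card Kˣ : ℕ) : ℝ) = Fintype.card K - 1 := by
    rw [Fintype.card_units, Nat.cast_sub Fintype.card_pos, Nat.cast_one]
  have hN : (0 : ℝ) < Fintype.card (ℙ K V) := by
    have : Nonempty (ℙ K V) := ⟨hS.choose⟩
    exact_mod_cast Fintype.card_pos
  have hcount : (uncoveredPoints S).card * (S.card * Fintype.card Kˣ) ≤
      ∑ x : ℙ K V, ((uncoveredPoints S).filter
        fun P => P ∉ uncoveredPoints (insert x S)).card := by
    have := Finset.sum_card_bipartiteAbove_eq_sum_card_bipartiteBelow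
      (s := uncoveredPoints S) (t := (Finset.univ : Finset (ℙ K V)))
      (fun P x => P ∉ uncoveredPoints (insert x S))
    simp only [Finset.bipartiteAbove, Finset.bipartiteBelow] at this
    rw [← this, ← smul_eq_mul]
    exact Finset.card_nsmul_le_sum _ _ _ fun P hP => card_mul_card_units_le_card_covering hP
  obtain ⟨x, -, hx⟩ : ∃ x ∈ (Finset.univ : Finset (ℙ K V)),
      ((uncoveredPoints S).card * (S.card * Fintype.card Kˣ) : ℝ) / Fintype.card (ℙ K V) ≤
      (((uncoveredPoints S).filter fun P => P ∉ uncoveredPoints (insert x S)).card : ℝ) := by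
    refine Finset.exists_le_of_sum_le ⟨hS.choose, Finset.mem_univ _⟩ ?_
    rw [Finset.sum_const, nsmul_eq_mul, Finset.card_univ, mul_div_cancel₀ _ hN.ne']
    exact_mod_cast hcount
  refine ⟨x, fun hxS => ?_, ?_⟩
  · rw [Finset.insert_eq_of_mem hxS] at hx
    have h0 : (uncoveredPoints S).filter (fun P => P ∉ uncoveredPoints S) = ∅ := by simp
    rw [h0, Finset.card_empty, Nat.cast_zero] at hx
    have h1 : 0 < (uncoveredPoints S).card := hS.card_pos
    have h2 : 0 < S.card := Finset.card_pos.2 ⟨x, hxS⟩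
    have h3 : 0 < Fintype.card Kˣ := Fintype.card_pos
    have : (0 : ℝ) < ((uncoveredPoints S).card * (S.card * Fintype.card Kˣ) : ℝ) /
      Fintype.card (ℙ K V) := by positivity
    linarith
  · have hsplit := Finset.card_filter_add_card_filter_not
      (s := uncoveredPoints S) (fun P => P ∈ uncoveredPoints (insert x S))
    rw [Finset.filter_mem_eq_inter,
      Finset.inter_eq_right.2 (uncoveredPoints_insert_subset S x)] at hsplit
    have hsplit' : ((uncoveredPoints (insert x S)).card : ℝ) +
      ((uncoveredPoints S).filter fun P => P ∉ uncoveredPoints (insert x S)).card =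
        (uncoveredPoints S).card := by exact_mod_cast hsplit
    rw [hq] at hx
    calc ((uncoveredPoints (insert x S)).card : ℝ) ≤ (uncoveredPoints S).card -
          (uncoveredPoints S).card * (S.card * (Fintype.card K - 1)) /
            Fintype.card (ℙ K V) := by linarith
      _ = _ := by ring

theorem exists_card_uncoveredPoints_le [Fintype K] (m : ℕ) :
    ∃ S : Finset (ℙ K V), S.card ≤ m ∧ ((uncoveredPoints S).Nonempty → S.card = m) ∧
      ((uncoveredPoints S).card : ℝ) ≤ Fintype.card (ℙ K V) *
        Real.exp (-(m * (m - 1) / 2 * ((Fintype.card K - 1) / Fintype.card (ℙ K V)))) := by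
  classical
  induction m with
  | zero => exact ⟨∅, by simp, by simp, by simpa using Finset.card_le_univ _⟩
  | succ m ih =>
    obtain ⟨S, h1, h2, h3⟩ := ih
    by_cases hS : (uncoveredPoints S).Nonempty
    · obtain ⟨x, hx, hle⟩ := exists_mul_card_uncoveredPoints_insert_le hS
      have hcard : (insert x S).card = m + 1 := by rw [Finset.card_insert_of_notMem hx, h2 hS]
      refine ⟨insert x S, hcard.le, fun _ => hcard, hle.trans ?_⟩
      rw [h2 hS]
      set r : ℝ := (Fintype.card K - 1) / Fintype.card (ℙ K V)
      calc ((uncoveredPoints S).card : ℝ) * (1 - m * r)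
          ≤ (uncoveredPoints S).card * Real.exp (-(m * r)) := by
            gcongr
            linarith [Real.add_one_le_exp (-(m * r))]
        _ ≤ (Fintype.card (ℙ K V) * Real.exp (-(m * (m - 1) / 2 * r))) *
            Real.exp (-(m * r)) := by gcongr
        _ = _ := by
            rw [mul_assoc, ← Real.exp_add]
            push_cast
            ring_nf
    · refine ⟨S, by omega, fun h => absurd h hS, ?_⟩
      rw [Finset.not_nonempty_iff_eq_empty.1 hS, Finset.card_empty, Nat.cast_zero]
      positivity

open Classical in
theorem exists_saturating_of_uncoveredPoints (S : Finset (ℙ K V)) (P : ℙ K V)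
    (hP : P ∉ S ∪ uncoveredPoints S) :
    ∃ a ∈ S, ∃ b ∈ S, a ≠ b ∧ P.rep ∈ Submodule.span K {a.rep, b.rep} := by
  rw [Finset.mem_union, not_or, mem_uncoveredPoints] at hP
  obtain ⟨hPS, hP⟩ := hP
  push Not at hP
  obtain ⟨a, ha, b, hb, hab⟩ := hP
  refine ⟨a, ha, b, hb, ?_, hab⟩
  rintro rfl
  exact hPS (Projectivization.eq_of_rep_mem_span_pair_self hab ▸ ha)

end

/-- The numerical estimate behind the choice of `k ≈ (1 + ε / 2) √((n + 1) q ^ (n - 1) ln q)`. -/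
theorem exists_nat_add_mul_exp_le {n : ℕ} (hn : 1 ≤ n) {ε q N : ℝ} (hε : 0 < ε) (hq : 2 ≤ q)
    (hlog : 64 / ε ^ 2 ≤ Real.log q) (hqε : 2 * (1 + ε) / ε ≤ q) (hN0 : 0 < N)
    (hN : N * (q - 1) ≤ q ^ (n + 1)) :
    ∃ k : ℕ, (k : ℝ) + N * Real.exp (-(k * (k - 1) / 2 * ((q - 1) / N))) ≤
      (1 + ε) * √((n + 1) * q ^ (n - 1) * Real.log q) := by
  obtain ⟨n, rfl⟩ : ∃ m, n = m + 1 := ⟨n - 1, by omega⟩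
  simp only [Nat.add_sub_cancel]
  set L := Real.log q with hL
  have hL0 : 0 < L := lt_of_lt_of_le (by positivity) hlog
  have hqn : 1 ≤ q ^ n := one_le_pow₀ (by linarith)
  push_cast
  set T := √(((n : ℝ) + 1 + 1) * q ^ n * L) with hT
  have hT2 : T ^ 2 = ((n : ℝ) + 1 + 1) * q ^ n * L := Real.sq_sqrt (by positivity)
  have hsL : 8 / ε ≤ √L := by
    apply Real.le_sqrt_of_sq_le
    rw [div_pow]
    norm_num
    exact hlog
  have hTq : √L * √(q ^ n) ≤ T := by
    rw [← Real.sqrt_mul hL0.le]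
    apply Real.sqrt_le_sqrt
    have : 0 ≤ q ^ n * L := by positivity
    have : 0 ≤ (n : ℝ) * (q ^ n * L) := by positivity
    nlinarith
  have hsq : 1 ≤ √(q ^ n) := Real.one_le_sqrt.2 hqn
  have h8 : 8 / ε * √(q ^ n) ≤ T := le_trans (by gcongr) hTq
  have h8' : 8 * √(q ^ n) ≤ ε * T := by
    rw [div_mul_eq_mul_div, div_le_iff₀ hε] at h8
    linarith
  refine ⟨⌊(1 + ε / 2) * T⌋₊ + 2, ?_⟩
  have hT0 : 0 ≤ T := Real.sqrt_nonneg _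
  have hfl : (⌊(1 + ε / 2) * T⌋₊ : ℝ) ≤ (1 + ε / 2) * T := Nat.floor_le (by positivity)
  have hfl' := Nat.lt_floor_add_one ((1 + ε / 2) * T)
  push_cast
  set f : ℝ := (⌊(1 + ε / 2) * T⌋₊ : ℝ)
  have hN2 : N ≤ 2 * q ^ (n + 1) := by
    have h1 : N * q ≤ (2 * q ^ (n + 1)) * q := by
      calc N * q ≤ 2 * (N * (q - 1)) := by nlinarith
        _ ≤ 2 * q ^ (n + 1 + 1) := by linarith
        _ = _ := by ring
    exact le_of_mul_le_mul_right h1 (by linarith)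
  have hkk : (1 + ε) * T ^ 2 ≤ (f + 2) * (f + 2 - 1) := by
    have h1 : 0 ≤ (1 + ε / 2) * T := by positivity
    have h2 : ((1 + ε / 2) * T) * ((1 + ε / 2) * T) ≤ (f + 2) * (f + 2 - 1) := by
      apply mul_le_mul <;> linarith
    nlinarith [sq_nonneg (ε * T)]
  have hr : (q - 1) ^ 2 / q ^ (n + 1 + 1) ≤ (q - 1) / N := by
    rw [div_le_div_iff₀ (by positivity) hN0]
    nlinarith
  have hqq : q ^ 2 ≤ (1 + ε) * (q - 1) ^ 2 := by
    rw [div_le_iff₀ hε] at hqε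
    nlinarith
  have hexp : ((n : ℝ) + 1 + 1) / 2 * L ≤ (f + 2) * (f + 2 - 1) / 2 * ((q - 1) / N) := by
    have hq1 : 0 ≤ (q - 1) ^ 2 / q ^ (n + 1 + 1) := by positivity
    calc ((n : ℝ) + 1 + 1) / 2 * L
        = (((n : ℝ) + 1 + 1) / 2 * L) * (q ^ 2 / q ^ 2) := by
          rw [div_self (by positivity), mul_one]
      _ ≤ (((n : ℝ) + 1 + 1) / 2 * L) * ((1 + ε) * (q - 1) ^ 2 / q ^ 2) := by gcongr
      _ = (1 + ε) * T ^ 2 / 2 * ((q - 1) ^ 2 / q ^ (n + 1 + 1)) := by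
          rw [hT2]
          field_simp
          ring
      _ ≤ _ := by
          apply mul_le_mul _ hr hq1
          · have : 0 ≤ (1 + ε) * T ^ 2 := by positivity
            linarith
          · linarith
  have hmain : N * Real.exp (-((f + 2) * (f + 2 - 1) / 2 * ((q - 1) / N))) ≤
      2 * √(q ^ n) := by
    have hq0 : 0 < q := by linarith
    have hexpL : Real.exp L = q := Real.exp_log hq0
    calc N * Real.exp (-((f + 2) * (f + 2 - 1) / 2 * ((q - 1) / N)))
        ≤ (2 * q ^ (n + 1)) * Real.exp (-(((n : ℝ) + 1 + 1) / 2 * L)) := by gcongr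
      _ = 2 * √(q ^ n) := by
          rw [mul_assoc, ← hexpL, ← Real.exp_nat_mul, ← Real.exp_nat_mul, ← Real.exp_half,
            ← Real.exp_add]
          push_cast
          ring_nf
  linarith

theorem card_projectivization_mul_sub_one_le (n : ℕ) (F : Type) [Field F] [Fintype F]
    [Fintype (ℙ F (Fin (n + 1) → F))] :
    (Fintype.card (ℙ F (Fin (n + 1) → F)) : ℝ) * (Fintype.card F - 1) ≤
      (Fintype.card F : ℝ) ^ (n + 1) := by
  have h := Projectivization.card F (Fin (n + 1) → F)
  rw [Nat.card_eq_fintype_card, Nat.card_eq_fintype_card, Nat.card_eq_fintype_card,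
    Fintype.card_fun, Fintype.card_fin] at h
  have h1 : Fintype.card (ℙ F (Fin (n + 1) → F)) * (Fintype.card F - 1) ≤
      Fintype.card F ^ (n + 1) := by omega
  have h2 : ((Fintype.card F - 1 : ℕ) : ℝ) = Fintype.card F - 1 := by
    rw [Nat.cast_sub Fintype.card_pos, Nat.cast_one]
  rw [← h2]
  exact_mod_cast h1

/-- For every n ≥ 2 and ε > 0, for all sufficiently large prime powers q,
PG(n,q) has a saturating set of size at most (1+ε)·√((n+1)·q^{n−1}·ln q). -/
theorem PG_exists_saturating_set (n : ℕ) (hn : 2 ≤ n) (ε : ℝ) (hε : 0 < ε) :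
    ∃ q₀ : ℕ, ∀ (F : Type) [Field F] [Fintype F],
      q₀ ≤ Fintype.card F →
      ∃ S : Set (Projectivization F (Fin (n + 1) → F)),
        (∀ P : Projectivization F (Fin (n + 1) → F), P ∉ S →
          ∃ a ∈ S, ∃ b ∈ S, a ≠ b ∧
            P.rep ∈ Submodule.span F {Projectivization.rep a, Projectivization.rep b}) ∧
        (S.ncard : ℝ) ≤ (1 + ε) * Real.sqrt (((n : ℝ) + 1) *
          ((Fintype.card F : ℝ) ^ (n - 1)) * Real.log (Fintype.card F)) := by
  classical
  have hev : ∀ᶠ q : ℕ in Filter.atTop, 64 / ε ^ 2 ≤ Real.log q ∧ 2 * (1 + ε) / ε ≤ (q : ℝ) :=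
    ((Real.tendsto_log_atTop.comp tendsto_natCast_atTop_atTop).eventually_ge_atTop _).and
      (tendsto_natCast_atTop_atTop.eventually_ge_atTop _)
  obtain ⟨q₀, hq₀⟩ := Filter.eventually_atTop.1 hev
  refine ⟨q₀, fun F _ _ hF => ?_⟩
  obtain ⟨hlog, hqε⟩ := hq₀ _ hF
  let _ : Fintype (ℙ F (Fin (n + 1) → F)) := Fintype.ofFinite _
  have hq : (2 : ℝ) ≤ Fintype.card F := by exact_mod_cast Fintype.one_lt_card (α := F)
  have hN0 : (0 : ℝ) < Fintype.card (ℙ F (Fin (n + 1) → F)) := by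
    exact_mod_cast Fintype.card_pos
  obtain ⟨k, hk⟩ := exists_nat_add_mul_exp_le (n := n) (by omega) hε hq hlog hqε hN0
    (card_projectivization_mul_sub_one_le n F)
  obtain ⟨S, hSk, -, hU⟩ :=
    exists_card_uncoveredPoints_le (K := F) (V := Fin (n + 1) → F) k
  refine ⟨(S ∪ uncoveredPoints S : Finset _), fun P hP => ?_, ?_⟩
  · obtain ⟨a, ha, b, hb, h⟩ :=
      exists_saturating_of_uncoveredPoints S P (by simpa only [Finset.mem_coe] using hP)
    exact ⟨a, by simp [ha], b, by simp [hb], h⟩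
  · rw [Set.ncard_coe_finset]
    have h1 : ((S ∪ uncoveredPoints S).card : ℝ) ≤ S.card + (uncoveredPoints S).card := by
      exact_mod_cast Finset.card_union_le _ _
    have h2 : (S.card : ℝ) ≤ k := by exact_mod_cast hSk
    linarith
end
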